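/- arXiv:math/0612823 — 3 statements merged into one kernel-verified Lean document; each statement's English description precedes it below -/
import Mathlib

section
/- Given 3N points in the plane ℝ², one can partition them into N triples (subsets of size 3) such that the convex hulls of all N triples have a point in common. -/
open Finset Matrix

/-- A family `v` of plane vectors has depth at least `n` at the origin if every closed half-plane
bounded by a line through the origin contains at least `n` members of the family. -/
def DepthAtLeast {ι : Type*} [Fintype ι] (n : ℕ) (v : ι → Fin 2 → ℝ) : Prop :=
  ∀ g : Fin 2 → ℝ, n ≤ #{j | g ⬝ᵥ v j ≤ 0}

/-- The argument of a plane vector, in `(-π, π]`. -/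
noncomputable def planeArg (x : Fin 2 → ℝ) : ℝ := Complex.arg ⟨x 0, x 1⟩

theorem cos_pos_iff_of_abs_lt {t : ℝ} (h₁ : -(2 * Real.pi) < t) (h₂ : t < 2 * Real.pi) :
    0 < Real.cos t ↔
      (-(Real.pi / 2) < t ∧ t < Real.pi / 2) ∨ t < -(3 * Real.pi / 2) ∨ 3 * Real.pi / 2 < t := by
  constructor
  · intro h
    by_contra! hc
    obtain ⟨hc₁, hc₂, hc₃⟩ := hc
    rcases le_or_gt t (-(Real.pi / 2)) with ht | ht
    · have := Real.cos_nonpos_of_pi_div_two_le_of_le (x := -t) (by linarith) (by linarith)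
      rw [Real.cos_neg] at this
      linarith
    · have := Real.cos_nonpos_of_pi_div_two_le_of_le (hc₁ ht) (by linarith)
      linarith
  · rintro (⟨ha, hb⟩ | h | h)
    · exact Real.cos_pos_of_mem_Ioo ⟨by linarith, hb⟩
    · rw [← Real.cos_add_two_pi]
      exact Real.cos_pos_of_mem_Ioo ⟨by linarith, by linarith⟩
    · rw [← Real.cos_sub_two_pi]
      exact Real.cos_pos_of_mem_Ioo ⟨by linarith, by linarith⟩

theorem complex_mk_ne_zero {x : Fin 2 → ℝ} (hx : x ≠ 0) : (⟨x 0, x 1⟩ : ℂ) ≠ 0 := by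
  contrapose! hx
  have := Complex.ext_iff.1 hx
  ext i
  fin_cases i
  exacts [this.1, this.2]

theorem dotProduct_eq_norm_mul_cos (g x : Fin 2 → ℝ) :
    g ⬝ᵥ x = ‖(⟨g 0, g 1⟩ : ℂ)‖ * ‖(⟨x 0, x 1⟩ : ℂ)‖ * Real.cos (planeArg x - planeArg g) := by
  have hpolar (y : Fin 2 → ℝ) : ‖(⟨y 0, y 1⟩ : ℂ)‖ * Real.cos (planeArg y) = y 0 ∧
      ‖(⟨y 0, y 1⟩ : ℂ)‖ * Real.sin (planeArg y) = y 1 :=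
    ⟨Complex.norm_mul_cos_arg _, Complex.norm_mul_sin_arg _⟩
  obtain ⟨hg₀, hg₁⟩ := hpolar g
  obtain ⟨hx₀, hx₁⟩ := hpolar x
  rw [dotProduct, Fin.sum_univ_two, Real.cos_sub]
  linear_combination -(x 0) * hg₀ - ‖(⟨g 0, g 1⟩ : ℂ)‖ * Real.cos (planeArg g) * hx₀ -
    x 1 * hg₁ - ‖(⟨g 0, g 1⟩ : ℂ)‖ * Real.sin (planeArg g) * hx₁

theorem dotProduct_pos_iff_planeArg {g x : Fin 2 → ℝ} (hg : g ≠ 0) (hx : x ≠ 0) :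
    0 < g ⬝ᵥ x ↔
      (-(Real.pi / 2) < planeArg x - planeArg g ∧ planeArg x - planeArg g < Real.pi / 2) ∨
        planeArg x - planeArg g < -(3 * Real.pi / 2) ∨
        3 * Real.pi / 2 < planeArg x - planeArg g := by
  have h₁ := norm_pos_iff.2 (complex_mk_ne_zero hg)
  have h₂ := norm_pos_iff.2 (complex_mk_ne_zero hx)
  rw [dotProduct_eq_norm_mul_cos, mul_pos_iff_of_pos_left (mul_pos h₁ h₂)]
  have h₃ := Complex.neg_pi_lt_arg ⟨g 0, g 1⟩
  have h₄ := Complex.arg_le_pi ⟨g 0, g 1⟩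
  have h₅ := Complex.neg_pi_lt_arg ⟨x 0, x 1⟩
  have h₆ := Complex.arg_le_pi ⟨x 0, x 1⟩
  apply cos_pos_iff_of_abs_lt <;> rw [planeArg, planeArg] <;> linarith

/-- Along vectors of increasing argument, a linear functional cannot have alternating signs. -/
theorem not_alternating_of_planeArg_le {g a b c d : Fin 2 → ℝ} (ha : a ≠ 0) (hb : b ≠ 0)
    (hc : c ≠ 0) (hd : d ≠ 0) (hab : planeArg a ≤ planeArg b) (hbc : planeArg b ≤ planeArg c)
    (hcd : planeArg c ≤ planeArg d) :
    ¬ (0 < g ⬝ᵥ a ∧ g ⬝ᵥ b ≤ 0 ∧ 0 < g ⬝ᵥ c ∧ g ⬝ᵥ d ≤ 0) ∧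
      ¬ (g ⬝ᵥ a ≤ 0 ∧ 0 < g ⬝ᵥ b ∧ g ⬝ᵥ c ≤ 0 ∧ 0 < g ⬝ᵥ d) := by
  rcases eq_or_ne g 0 with rfl | hg
  · simp
  have h₁ := Complex.neg_pi_lt_arg ⟨a 0, a 1⟩
  have h₂ := Complex.arg_le_pi ⟨d 0, d 1⟩
  have h₃ := Complex.neg_pi_lt_arg ⟨g 0, g 1⟩
  have h₄ := Complex.arg_le_pi ⟨g 0, g 1⟩
  change -Real.pi < planeArg a at h₁
  change planeArg d ≤ Real.pi at h₂
  change -Real.pi < planeArg g at h₃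
  change planeArg g ≤ Real.pi at h₄
  simp only [← not_lt, dotProduct_pos_iff_planeArg hg ha, dotProduct_pos_iff_planeArg hg hb,
    dotProduct_pos_iff_planeArg hg hc, dotProduct_pos_iff_planeArg hg hd]
  generalize planeArg a = α at *
  generalize planeArg b = β at *
  generalize planeArg c = γ at *
  generalize planeArg d = δ at *
  generalize planeArg g = φ at *
  generalize Real.pi = π at *
  constructor <;> grind

theorem exists_dotProduct_eq (f : StrongDual ℝ (Fin 2 → ℝ)) :
    ∃ g : Fin 2 → ℝ, ∀ x, f x = g ⬝ᵥ x := by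
  refine ⟨fun i => f (Pi.single i 1), fun x => ?_⟩
  conv_lhs => rw [← Finset.univ_sum_single x, map_sum]
  refine Finset.sum_congr rfl fun i _ => ?_
  rw [mul_comm, ← smul_eq_mul, ← map_smul, ← Pi.single_smul, smul_eq_mul, mul_one]

theorem exists_dotProduct_pos_of_zero_notMem_convexHull {s : Set (Fin 2 → ℝ)} (hs : s.Finite)
    (h : (0 : Fin 2 → ℝ) ∉ convexHull ℝ s) : ∃ g : Fin 2 → ℝ, ∀ x ∈ s, 0 < g ⬝ᵥ x := by
  obtain ⟨f, u, hu, hf⟩ := geometric_hahn_banach_point_closed (convex_convexHull ℝ s)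
    (hs.isClosed_convexHull ℝ) h
  obtain ⟨g, hg⟩ := exists_dotProduct_eq f
  refine ⟨g, fun x hx => ?_⟩
  rw [← hg]
  rw [map_zero] at hu
  exact hu.trans (hf x (subset_convexHull ℝ s hx))

/-- If nonzero vectors sorted by argument have depth at least `N` at the origin, then any triple of
vectors whose indices are `N` apart contains the origin in its convex hull. -/
theorem zero_mem_convexHull_of_monotone_planeArg {N : ℕ} {v : Fin (3 * N) → Fin 2 → ℝ}
    (hv : ∀ j, v j ≠ 0) (hmono : Monotone fun j => planeArg (v j)) (hdepth : DepthAtLeast N v)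
    (i : Fin N) :
    (0 : Fin 2 → ℝ) ∈ convexHull ℝ (Set.range fun k : Fin 3 => v (finProdFinEquiv (k, i))) := by
  by_contra h
  obtain ⟨g, hg⟩ := exists_dotProduct_pos_of_zero_notMem_convexHull (Set.finite_range _) h
  have hi := i.2
  have hpos : ∀ j : Fin (3 * N), (j : ℕ) = i ∨ (j : ℕ) = i + N ∨ (j : ℕ) = i + 2 * N →
      0 < g ⬝ᵥ v j := by
    have key : ∀ (k : Fin 3) (j : Fin (3 * N)), (j : ℕ) = i + N * k → 0 < g ⬝ᵥ v j := by
      intro k j hj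
      have : j = finProdFinEquiv (k, i) := Fin.ext hj
      rw [this]
      exact hg _ ⟨k, rfl⟩
    rintro j (hj | hj | hj)
    · exact key 0 j (by simpa using hj)
    · exact key 1 j (by simpa using hj)
    · exact key 2 j (by simpa [mul_comm] using hj)
  have halt : ∀ a b c d : Fin (3 * N), a ≤ b → b ≤ c → c ≤ d →
      ¬ (0 < g ⬝ᵥ v a ∧ g ⬝ᵥ v b ≤ 0 ∧ 0 < g ⬝ᵥ v c ∧ g ⬝ᵥ v d ≤ 0) ∧
      ¬ (g ⬝ᵥ v a ≤ 0 ∧ 0 < g ⬝ᵥ v b ∧ g ⬝ᵥ v c ≤ 0 ∧ 0 < g ⬝ᵥ v d) :=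
    fun a b c d hab hbc hcd => not_alternating_of_planeArg_le (hv a) (hv b) (hv c) (hv d)
      (hmono hab) (hmono hbc) (hmono hcd)
  let p₀ : Fin (3 * N) := ⟨i, by omega⟩
  let p₁ : Fin (3 * N) := ⟨i + N, by omega⟩
  let p₂ : Fin (3 * N) := ⟨i + 2 * N, by omega⟩
  have hp₀ : 0 < g ⬝ᵥ v p₀ := hpos _ (Or.inl rfl)
  have hp₁ : 0 < g ⬝ᵥ v p₁ := hpos _ (Or.inr (Or.inl rfl))
  have hp₂ : 0 < g ⬝ᵥ v p₂ := hpos _ (Or.inr (Or.inr rfl))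
  set G : Finset (Fin (3 * N)) := {j | g ⬝ᵥ v j ≤ 0}
  have hGcard : N ≤ #G := hdepth g
  have hmem : ∀ j ∈ G, g ⬝ᵥ v j ≤ 0 := fun j hj => (Finset.mem_filter.1 hj).2
  have hne : ∀ j ∈ G, j ≠ p₀ ∧ j ≠ p₁ ∧ j ≠ p₂ := by
    intro j hj
    have := hmem j hj
    refine ⟨?_, ?_, ?_⟩ <;> rintro rfl <;> linarith
  have hsmall : ¬ ∃ a b : Fin (3 * N), (b : ℕ) = a + N ∧ G ⊆ Ioo a b := by
    rintro ⟨a, b, hab, hsub⟩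
    have := Finset.card_le_card hsub
    rw [Fin.card_Ioo] at this
    omega
  by_cases h₀ : ∃ j ∈ G, p₀ < j ∧ j < p₁
  · obtain ⟨j, hj, hj₀, hj₁⟩ := h₀
    refine hsmall ⟨p₀, p₁, rfl, fun k hk => Finset.mem_Ioo.2 ⟨?_, ?_⟩⟩ <;> by_contra! hle
    · exact (halt k p₀ j p₁ hle hj₀.le hj₁.le).2 ⟨hmem k hk, hp₀, hmem j hj, hp₁⟩
    · exact (halt p₀ j p₁ k hj₀.le hj₁.le hle).1 ⟨hp₀, hmem j hj, hp₁, hmem k hk⟩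
  by_cases h₁ : ∃ j ∈ G, p₁ < j ∧ j < p₂
  · obtain ⟨j, hj, hj₁, hj₂⟩ := h₁
    refine hsmall ⟨p₁, p₂, ?_, fun k hk => Finset.mem_Ioo.2 ⟨?_, ?_⟩⟩
    · simp only [p₁, p₂]
      omega
    all_goals by_contra! hle
    · exact (halt k p₁ j p₂ hle hj₁.le hj₂.le).2 ⟨hmem k hk, hp₁, hmem j hj, hp₂⟩
    · exact (halt p₁ j p₂ k hj₁.le hj₂.le hle).1 ⟨hp₁, hmem j hj, hp₂, hmem k hk⟩
  have hsub : G ⊆ Iio p₀ ∪ Ioi p₂ := by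
    intro k hk
    have := hne k hk
    rw [Finset.mem_union, Finset.mem_Iio, Finset.mem_Ioi]
    grind
  have hle := (Finset.card_le_card hsub).trans (Finset.card_union_le _ _)
  rw [Fin.card_Iio, Fin.card_Ioi] at hle
  simp only [p₀, p₂] at hle
  omega

/-- Nonzero vectors of depth at least `N` at the origin can be split into `N` triples containing
the origin in their convex hulls. -/
theorem exists_equiv_zero_mem_convexHull_of_ne_zero {N : ℕ} {v : Fin (3 * N) → Fin 2 → ℝ}
    (hv : ∀ j, v j ≠ 0) (hdepth : DepthAtLeast N v) :
    ∃ e : Fin 3 × Fin N ≃ Fin (3 * N), ∀ i,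
      (0 : Fin 2 → ℝ) ∈ convexHull ℝ (Set.range fun k => v (e (k, i))) := by
  let σ := Tuple.sort fun j => planeArg (v j)
  refine ⟨finProdFinEquiv.trans σ, fun i => ?_⟩
  refine zero_mem_convexHull_of_monotone_planeArg (v := v ∘ σ) (fun j => hv _)
    (Tuple.monotone_sort fun j => planeArg (v j)) (fun g => (hdepth g).trans_eq ?_) i
  refine (Finset.card_equiv σ fun j => ?_).symm
  simp

/-- A zero vector in a family of depth at least `N` can be replaced by a nonzero one without
the depth dropping below `N`. -/
theorem exists_ne_zero_depthAtLeast_update {N : ℕ} {v : Fin (3 * N) → Fin 2 → ℝ}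
    {j₀ : Fin (3 * N)} (hj₀ : v j₀ = 0) (hdepth : DepthAtLeast N v) :
    ∃ w : Fin 2 → ℝ, w ≠ 0 ∧ DepthAtLeast N (Function.update v j₀ w) := by
  have hN := j₀.2
  let T : Set (Fin 2 → ℝ) := {g | 2 * N ≤ #{j | 0 < g ⬝ᵥ v j}}
  have hT : IsOpen T := by
    have : T = ⋃ s ∈ {s : Finset (Fin (3 * N)) | 2 * N ≤ #s}, ⋂ j ∈ s, {g | 0 < g ⬝ᵥ v j} := by
      ext g
      simp only [T, Set.mem_ofPred_eq, Set.mem_iUnion, Set.mem_iInter, exists_prop]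
      constructor
      · exact fun h => ⟨_, h, by simp⟩
      · rintro ⟨s, hs, h⟩
        exact hs.trans (Finset.card_le_card fun j hj => by simpa using h j hj)
    rw [this]
    refine isOpen_biUnion fun s _ => isOpen_biInter_finset fun j _ => ?_
    exact isOpen_lt continuous_const (continuous_id.dotProduct continuous_const)
  have hcompl : ∀ g : Fin 2 → ℝ, #{j | 0 < g ⬝ᵥ v j} + #{j | g ⬝ᵥ v j ≤ 0} = 3 * N := by
    intro g
    have := Finset.card_filter_add_card_filter_not (s := univ) fun j => 0 < g ⬝ᵥ v j
    simpa using this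
  have hzero : (0 : Fin 2 → ℝ) ∉ convexHull ℝ T := by
    intro h
    rw [convexHull_eq_union] at h
    simp only [Set.mem_iUnion] at h
    obtain ⟨t, htT, hind, ht⟩ := h
    have hcard : #t ≤ 3 := by
      have := hind.card_le_finrank_succ
      have h2 := Submodule.finrank_le (vectorSpan ℝ (Set.range ((↑) : t → Fin 2 → ℝ)))
      simp at this h2
      omega
    have hcover : (univ : Finset (Fin (3 * N))).erase j₀ ⊆
        t.biUnion fun g => {j | g ⬝ᵥ v j ≤ 0 ∧ j ≠ j₀} := by
      intro j hj
      simp only [Finset.mem_biUnion, Finset.mem_filter, Finset.mem_univ, true_and]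
      by_contra! hc
      have hsub : convexHull ℝ (t : Set (Fin 2 → ℝ)) ⊆ {g | 0 < g ⬝ᵥ v j} := by
        refine convexHull_min (fun g hg => ?_) ?_
        · by_contra hn
          exact (Finset.ne_of_mem_erase hj) (hc g hg (not_lt.1 hn))
        · exact convex_halfSpace_gt
            ⟨fun x y => add_dotProduct x y _, fun c x => smul_dotProduct c x _⟩ 0
      have := hsub ht
      simp at this
    have hle := (Finset.card_le_card hcover).trans (Finset.card_biUnion_le_card_mul _ _ (N - 1) ?_)
    · rw [Finset.card_erase_of_mem (Finset.mem_univ _), Finset.card_univ, Fintype.card_fin] at hle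
      have := Nat.mul_le_mul_right (N - 1) hcard
      omega
    · intro g hg
      have h₁ : 2 * N ≤ #{j | 0 < g ⬝ᵥ v j} := htT hg
      have h₂ := hcompl g
      have h₃ : ({j | g ⬝ᵥ v j ≤ 0 ∧ j ≠ j₀} : Finset (Fin (3 * N))) =
          ({j | g ⬝ᵥ v j ≤ 0} : Finset (Fin (3 * N))).erase j₀ := by
        ext j
        simp [and_comm]
      rw [h₃, Finset.card_erase_of_mem (by simp [hj₀])]
      omega
  obtain ⟨w, hw, hTw⟩ : ∃ w : Fin 2 → ℝ, w ≠ 0 ∧ ∀ g ∈ T, g ⬝ᵥ w ≤ 0 := by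
    obtain ⟨f, hf⟩ := geometric_hahn_banach_open_point (convex_convexHull ℝ T) hT.convexHull hzero
    obtain ⟨w, hfw⟩ := exists_dotProduct_eq f
    rw [map_zero] at hf
    have hlt : ∀ g ∈ T, g ⬝ᵥ w < 0 := fun g hg => by
      rw [dotProduct_comm, ← hfw]
      exact hf g (subset_convexHull ℝ T hg)
    rcases T.eq_empty_or_nonempty with hE | ⟨g, hg⟩
    · exact ⟨1, one_ne_zero, by simp [hE]⟩
    · refine ⟨w, ?_, fun g hg => (hlt g hg).le⟩
      rintro rfl
      simpa using hlt g hg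
  refine ⟨w, hw, fun g => ?_⟩
  have hd := hdepth g
  by_cases hg : g ∈ T
  · refine hd.trans (Finset.card_le_card fun j hj => ?_)
    rcases eq_or_ne j j₀ with rfl | hne
    · simpa using hTw g hg
    · simpa [hne] using hj
  · have h₁ : #{j | 0 < g ⬝ᵥ v j} < 2 * N := not_le.1 hg
    have h₂ := hcompl g
    have h₃ : ({j | g ⬝ᵥ v j ≤ 0} : Finset (Fin (3 * N))).erase j₀ ⊆
        ({j | g ⬝ᵥ Function.update v j₀ w j ≤ 0} : Finset (Fin (3 * N))) := by
      intro j hj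
      have hne := Finset.ne_of_mem_erase hj
      simpa [hne] using Finset.mem_of_mem_erase hj
    have h₄ := Finset.card_le_card h₃
    rw [Finset.card_erase_of_mem (by simp [hj₀])] at h₄
    omega

/-- Distinct vectors of depth at least `N` at the origin can be split into `N` triples containing
the origin in their convex hulls. -/
theorem exists_equiv_zero_mem_convexHull {N : ℕ} {v : Fin (3 * N) → Fin 2 → ℝ}
    (hv : Function.Injective v) (hdepth : DepthAtLeast N v) :
    ∃ e : Fin 3 × Fin N ≃ Fin (3 * N), ∀ i,
      (0 : Fin 2 → ℝ) ∈ convexHull ℝ (Set.range fun k => v (e (k, i))) := by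
  by_cases h : ∀ j, v j ≠ 0
  · exact exists_equiv_zero_mem_convexHull_of_ne_zero h hdepth
  push Not at h
  obtain ⟨j₀, hj₀⟩ := h
  obtain ⟨w, hw, hdw⟩ := exists_ne_zero_depthAtLeast_update hj₀ hdepth
  have hne_zero : ∀ j, Function.update v j₀ w j ≠ 0 := by
    intro j
    rcases eq_or_ne j j₀ with rfl | hne
    · simpa using hw
    · rw [Function.update_of_ne hne, ← hj₀]
      exact hv.ne hne
  obtain ⟨e, he⟩ := exists_equiv_zero_mem_convexHull_of_ne_zero hne_zero hdw
  refine ⟨e, fun i => ?_⟩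
  by_cases hi : ∃ k, e (k, i) = j₀
  · obtain ⟨k, hk⟩ := hi
    exact subset_convexHull ℝ _ ⟨k, by simp [hk, hj₀]⟩
  · push Not at hi
    simpa [hi] using he i

/-- The centerpoint theorem in the plane: some point lies in the convex hull of every subset of
more than two thirds of the given points. -/
theorem exists_mem_convexHull_of_two_thirds (N : ℕ) (X : Finset (Fin 2 → ℝ))
    (hX : #X = 3 * N) :
    ∃ p : Fin 2 → ℝ, ∀ S ⊆ X, 2 * N < #S → p ∈ convexHull ℝ (S : Set (Fin 2 → ℝ)) := by
  rcases Nat.eq_zero_or_pos N with rfl | hN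
  · refine ⟨0, fun S hS hc => ?_⟩
    have := Finset.card_le_card hS
    omega
  have := Convex.helly_theorem' (𝕜 := ℝ) (s := {S ∈ X.powerset | 2 * N < #S})
    (F := fun S : Finset (Fin 2 → ℝ) => convexHull ℝ (S : Set (Fin 2 → ℝ)))
    (fun S _ => convex_convexHull ℝ _) ?_
  · obtain ⟨p, hp⟩ := this
    refine ⟨p, fun S hS hc => ?_⟩
    simp only [Set.mem_iInter] at hp
    exact hp S (by simp [hS, hc])
  · intro I hI hIcard
    simp only [Module.finrank_fintype_fun_eq_card, Fintype.card_fin] at hIcard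
    have hbound : #(I.biUnion fun S => X \ S) ≤ #I * (N - 1) := by
      refine Finset.card_biUnion_le_card_mul _ _ _ fun S hS => ?_
      have h := Finset.mem_filter.1 (hI hS)
      rw [Finset.card_sdiff_of_subset (Finset.mem_powerset.1 h.1)]
      omega
    have hlt : #(I.biUnion fun S => X \ S) < #X := by
      have := Nat.mul_le_mul_right (N - 1) hIcard
      omega
    obtain ⟨x, hxX, hx⟩ := Finset.exists_mem_notMem_of_card_lt_card hlt
    refine ⟨x, Set.mem_iInter₂.2 fun S hS => subset_convexHull ℝ _ ?_⟩
    by_contra hxS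
    exact hx (Finset.mem_biUnion.2 ⟨S, hS, Finset.mem_sdiff.2 ⟨hxX, hxS⟩⟩)

/-- Any `3N` distinct points have depth at least `N` at some point of the plane. -/
theorem exists_depthAtLeast_sub {N : ℕ} {v : Fin (3 * N) → Fin 2 → ℝ}
    (hv : Function.Injective v) :
    ∃ p : Fin 2 → ℝ, DepthAtLeast N fun j => v j - p := by
  obtain ⟨p, hp⟩ := exists_mem_convexHull_of_two_thirds N (univ.image v)
    (by rw [Finset.card_image_of_injective _ hv, Finset.card_univ, Fintype.card_fin])
  refine ⟨p, fun g => ?_⟩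
  by_contra! hlt
  have hcompl : #{j | 0 < g ⬝ᵥ (v j - p)} + #{j | g ⬝ᵥ (v j - p) ≤ 0} = 3 * N := by
    have := Finset.card_filter_add_card_filter_not (s := univ) fun j => 0 < g ⬝ᵥ (v j - p)
    simpa using this
  have hmem := hp (({j | 0 < g ⬝ᵥ (v j - p)} : Finset (Fin (3 * N))).image v)
    (Finset.image_subset_image (Finset.subset_univ _))
    (by rw [Finset.card_image_of_injective _ hv]; omega)
  have hsub : convexHull ℝ ((({j | 0 < g ⬝ᵥ (v j - p)} : Finset (Fin (3 * N))).image v :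
      Finset (Fin 2 → ℝ)) : Set (Fin 2 → ℝ)) ⊆ {x | g ⬝ᵥ p < g ⬝ᵥ x} := by
    refine convexHull_min (fun x hx => ?_) ?_
    · obtain ⟨j, hj, rfl⟩ := Finset.mem_image.1 hx
      have := (Finset.mem_filter.1 hj).2
      rw [dotProduct_sub] at this
      exact sub_pos.1 this
    · exact convex_halfSpace_gt ⟨dotProduct_add g, fun c x => dotProduct_smul c g x⟩ _
  exact lt_irrefl (g ⬝ᵥ p) (hsub hmem)

/-- **Birch's theorem (1959).** Given `3N` points in the plane `ℝ²`, one can partition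
them into `N` triples such that the convex hulls of all `N` triples have a point in
common. -/
theorem birch_theorem (N : ℕ) (X : Finset (Fin 2 → ℝ)) (hX : X.card = 3 * N) :
    ∃ P : Finset (Finset (Fin 2 → ℝ)),
      P.card = N ∧
      (∀ F ∈ P, F.card = 3) ∧
      (∀ F ∈ P, ∀ G ∈ P, F ≠ G → Disjoint F G) ∧
      (∀ x, x ∈ X ↔ ∃ F ∈ P, x ∈ F) ∧
      ∃ p : Fin 2 → ℝ, ∀ F ∈ P, p ∈ convexHull ℝ (F : Set (Fin 2 → ℝ)) := by
  let enum := (X.equivFinOfCardEq hX).symm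
  let v : Fin (3 * N) → Fin 2 → ℝ := fun j => enum j
  have hv : Function.Injective v := Subtype.val_injective.comp enum.injective
  obtain ⟨p, hp⟩ := exists_depthAtLeast_sub hv
  obtain ⟨e, he⟩ := exists_equiv_zero_mem_convexHull
    (fun a b hab => hv (sub_left_injective hab)) hp
  have hve : Function.Injective fun q => v (e q) := hv.comp e.injective
  let T : Fin N → Finset (Fin 2 → ℝ) := fun i => univ.image fun k => v (e (k, i))
  have hT : ∀ i x, x ∈ T i ↔ ∃ k, v (e (k, i)) = x := by simp [T]
  have hdisj : ∀ i i', i ≠ i' → Disjoint (T i) (T i') := by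
    intro i i' hne
    rw [Finset.disjoint_left]
    intro x hx hx'
    obtain ⟨k, rfl⟩ := (hT _ _).1 hx
    obtain ⟨k', hk'⟩ := (hT _ _).1 hx'
    exact hne (Prod.ext_iff.1 (hve hk')).2.symm
  have hTinj : Function.Injective T := by
    intro i i' h
    by_contra hne
    have hd := hdisj i i' hne
    rw [← h, disjoint_self] at hd
    have := (hT i _).2 ⟨0, rfl⟩
    rw [hd] at this
    exact Finset.notMem_empty _ this
  refine ⟨univ.image T, ?_, ?_, ?_, ?_, p, ?_⟩
  · rw [Finset.card_image_of_injective _ hTinj, Finset.card_univ, Fintype.card_fin]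
  · simp only [Finset.mem_image, Finset.mem_univ, true_and, forall_exists_index,
      forall_apply_eq_imp_iff]
    intro i
    rw [Finset.card_image_of_injective _ fun k k' h => (Prod.ext_iff.1 (hve h)).1,
      Finset.card_univ, Fintype.card_fin]
  · simp only [Finset.mem_image, Finset.mem_univ, true_and, forall_exists_index,
      forall_apply_eq_imp_iff]
    exact fun i i' hne => hdisj i i' fun h => hne (h ▸ rfl)
  · intro x
    simp only [Finset.mem_image, Finset.mem_univ, true_and, exists_exists_eq_and, hT]
    constructor
    · intro hx
      refine ⟨(e.symm (enum.symm ⟨x, hx⟩)).2, (e.symm (enum.symm ⟨x, hx⟩)).1, ?_⟩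
      simp [v]
    · rintro ⟨i, k, rfl⟩
      exact (enum _).2
  · simp only [Finset.mem_image, Finset.mem_univ, true_and, forall_exists_index,
      forall_apply_eq_imp_iff]
    intro i
    let τ : (Fin 2 → ℝ) →ᵃ[ℝ] (Fin 2 → ℝ) := AffineMap.id ℝ _ + AffineMap.const ℝ _ p
    have hmem := Set.mem_image_of_mem τ (he i)
    rw [AffineMap.image_convexHull, ← Set.range_comp] at hmem
    simpa [τ, T, Function.comp_def] using hmem
end

section
/- Let d ≥ 1 and q ≥ 1 be integers. Any set of (q−1)(d+1)+1 points in ℝ^d can be partitioned into q subsets such that the convex hulls of all q subsets have a point in common. -/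
open Module

/-- A point of minimal norm in a convex set `C` bounds the inner products against `C` below. -/
theorem Convex.norm_sq_le_inner_of_forall_norm_le {E : Type*} [NormedAddCommGroup E]
    [InnerProductSpace ℝ E] {C : Set E} (hC : Convex ℝ C) {z : E} (hz : z ∈ C)
    (hmin : ∀ y ∈ C, ‖z‖ ≤ ‖y‖) {y : E} (hy : y ∈ C) : ‖z‖ ^ 2 ≤ inner ℝ z y := by
  have : Nonempty C := ⟨⟨z, hz⟩⟩
  have hinf : ‖(0 : E) - z‖ = ⨅ w : C, ‖(0 : E) - w‖ := by
    refine le_antisymm (le_ciInf fun w => by simpa using hmin w w.2) ?_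
    exact ciInf_le ⟨0, Set.forall_mem_range.2 fun _ => norm_nonneg _⟩ (⟨z, hz⟩ : C)
  have h := (norm_eq_iInf_iff_real_inner_le_zero hC hz).1 hinf y hy
  rw [zero_sub, inner_neg_left, inner_sub_right, real_inner_self_eq_norm_sq] at h
  linarith

/-- An affinely independent family in an affine hyperplane has at most `finrank ℝ E` members. -/
theorem AffineIndependent.card_le_finrank_of_inner_eq {E ι : Type*} [NormedAddCommGroup E]
    [InnerProductSpace ℝ E] [FiniteDimensional ℝ E] [Fintype ι] {v : ι → E}
    (hv : AffineIndependent ℝ v) {a : E} (ha : a ≠ 0) {c : ℝ} (h : ∀ i, inner ℝ a (v i) = c) :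
    Fintype.card ι ≤ finrank ℝ E := by
  have hspan : vectorSpan ℝ (Set.range v) ≤ (ℝ ∙ a)ᗮ := by
    rw [vectorSpan_def, Submodule.span_le]
    rintro _ ⟨_, ⟨i, rfl⟩, _, ⟨j, rfl⟩, rfl⟩
    simp [Submodule.mem_orthogonal_singleton_iff_inner_right, inner_sub_right, h]
  have hle := Submodule.finrank_mono hspan
  have hadd := (ℝ ∙ a).finrank_add_finrank_orthogonal
  rw [finrank_span_singleton ha] at hadd
  have hcard := hv.card_le_finrank_succ
  omega

/-- **Colorful Carathéodory theorem**: given more than `finrank ℝ E` finite families of points,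
each having `0` in its convex hull, one point can be selected from each family such that `0` is in
the convex hull of the selected points. -/
theorem exists_zero_mem_convexHull_range_selection {E ι κ : Type*} [NormedAddCommGroup E]
    [InnerProductSpace ℝ E] [FiniteDimensional ℝ E] [Fintype ι] [Finite κ] (p : ι → κ → E)
    (hp : ∀ i, (0 : E) ∈ convexHull ℝ (Set.range (p i))) (hcard : finrank ℝ E < Fintype.card ι) :
    ∃ s : ι → κ, (0 : E) ∈ convexHull ℝ (Set.range fun i => p i (s i)) := by
  classical
  have hι : Nonempty ι := Fintype.card_pos_iff.1 (by omega)
  have hκ (i : ι) : Nonempty κ :=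
    Set.range_nonempty_iff_nonempty.1 (convexHull_nonempty_iff.1 ⟨_, hp i⟩)
  let C (s : ι → κ) : Set E := convexHull ℝ (Set.range fun i => p i (s i))
  have hsub (s : ι → κ) (i : ι) : p i (s i) ∈ C s := subset_convexHull ℝ _ ⟨i, rfl⟩
  have hcompact : IsCompact (⋃ s, C s) :=
    isCompact_iUnion fun s => (Set.finite_range _).isCompact_convexHull ℝ
  have hne : (⋃ s, C s).Nonempty :=
    ⟨_, Set.mem_iUnion.2 ⟨fun i => (hκ i).some, hsub _ hι.some⟩⟩
  obtain ⟨z, hz, hmin⟩ := hcompact.exists_isMinOn hne continuous_norm.continuousOn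
  obtain ⟨s, hs⟩ := Set.mem_iUnion.1 hz
  replace hmin (t : ι → κ) (y : E) (hy : y ∈ C t) : ‖z‖ ≤ ‖y‖ := hmin (Set.mem_iUnion.2 ⟨t, hy⟩)
  have hinner (t : ι → κ) (hzt : z ∈ C t) (y : E) (hy : y ∈ C t) : ‖z‖ ^ 2 ≤ inner ℝ z y :=
    (convex_convexHull ℝ _).norm_sq_le_inner_of_forall_norm_le hzt (hmin t) hy
  rcases eq_or_ne z 0 with rfl | hz0
  · exact ⟨s, hs⟩
  exfalso
  obtain ⟨τ, _, v, w, hv, haff, hw, hw1, hwz⟩ := eq_pos_convex_span_of_mem_convexHull hs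
  have hvC (j : τ) : v j ∈ C s := subset_convexHull ℝ _ (hv ⟨j, rfl⟩)
  have hveq (j : τ) : inner ℝ z (v j) = ‖z‖ ^ 2 := by
    have hsum : ∑ j, w j * ‖z‖ ^ 2 = ∑ j, w j * inner ℝ z (v j) := by
      rw [← Finset.sum_mul, hw1, one_mul, ← real_inner_self_eq_norm_sq]
      nth_rewrite 2 [← hwz]
      simp [inner_sum, inner_smul_right]
    have h := (Finset.sum_eq_sum_iff_of_le fun j _ =>
      mul_le_mul_of_nonneg_left (hinner s hs _ (hvC j)) (hw j).le).1 hsum j (Finset.mem_univ j)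
    exact (mul_left_cancel₀ (hw j).ne' h).symm
  choose g hg using fun j => hv ⟨j, rfl⟩
  obtain ⟨i, hi⟩ : ∃ i, ∀ j, g j ≠ i := by
    by_contra! hsurj
    have := Fintype.card_le_of_surjective g hsurj
    have := haff.card_le_finrank_of_inner_eq hz0 hveq
    omega
  obtain ⟨k, hk⟩ : ∃ k, inner ℝ z (p i k) ≤ 0 := by
    by_contra! hpos
    have hsubset : Set.range (p i) ⊆ {y | 0 < innerₛₗ ℝ z y} := Set.range_subset_iff.2 hpos
    have hmem := convexHull_min hsubset (convex_halfSpace_gt (innerₛₗ ℝ z).isLinear 0) (hp i)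
    simp at hmem
  have hzt : z ∈ C (Function.update s i k) := by
    refine mem_convexHull_of_exists_fintype w v (fun j => (hw j).le) hw1 (fun j => ⟨g j, ?_⟩) hwz
    simpa [Function.update_of_ne (hi j)] using hg j
  have hle := hinner _ hzt _ (hsub _ i)
  rw [Function.update_self] at hle
  have : 0 < ‖z‖ ^ 2 := by positivity
  linarith

/-- Points in the convex hull of a finite family are convex combinations of the whole family. -/
theorem exists_weights_of_mem_convexHull_range {E ι : Type*} [AddCommGroup E] [Module ℝ E]
    [Fintype ι] {v : ι → E} {x : E} (hx : x ∈ convexHull ℝ (Set.range v)) :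
    ∃ w : ι → ℝ, (∀ i, 0 ≤ w i) ∧ ∑ i, w i = 1 ∧ ∑ i, w i • v i = x := by
  classical
  rw [convexHull_range_eq_exists_affineCombination] at hx
  obtain ⟨t, w, hw, hw1, rfl⟩ := hx
  refine ⟨fun i => if i ∈ t then w i else 0, fun i => ?_, by simpa using hw1, ?_⟩
  · dsimp only
    split_ifs with h
    exacts [hw i h, le_rfl]
  · simp [t.affineCombination_eq_linear_combination v w hw1, ite_smul]

/-- Tverberg's theorem for indexed families, with the `r + 1` parts labelled by
`Option (Fin r)`. -/
theorem exists_coloring_forall_mem_convexHull {ι : Type*} [Fintype ι] {d r : ℕ}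
    (x : ι → Fin d → ℝ) (hcard : Fintype.card ι = r * (d + 1) + 1) :
    ∃ (s : ι → Option (Fin r)) (p : Fin d → ℝ),
      ∀ k, p ∈ convexHull ℝ (x '' {i | s i = k}) := by
  classical
  -- Sarkaria's tensor trick: `u` spans `ℝ ^ r`, with `∑ k, u k = 0` as its only linear relation.
  let u (k : Option (Fin r)) (a : Fin r) : ℝ := k.elim (-1) fun j => if j = a then 1 else 0
  let y (i : ι) (b : Option (Fin d)) : ℝ := b.elim 1 (x i)
  let v (i : ι) (k : Option (Fin r)) : EuclideanSpace ℝ (Fin r × Option (Fin d)) :=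
    WithLp.toLp 2 fun c => u k c.1 * y i c.2
  have hv (i : ι) : 0 ∈ convexHull ℝ (Set.range (v i)) := by
    refine mem_convexHull_of_exists_fintype (fun _ => ((r : ℝ) + 1)⁻¹) (v i)
      (fun _ => by positivity) ?_ (fun k => ⟨k, rfl⟩) ?_
    · simp
      field_simp
    · ext c
      simp [v, u, Fintype.sum_option]
  obtain ⟨s, hs⟩ := exists_zero_mem_convexHull_range_selection v hv (by simp [hcard])
  obtain ⟨w, hw0, hw1, hw⟩ := exists_weights_of_mem_convexHull_range hs
  let S (k : Option (Fin r)) (b : Option (Fin d)) : ℝ := ∑ i with s i = k, w i * y i b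
  have hS (k : Option (Fin r)) (b : Option (Fin d)) : S k b = S none b := by
    cases k with
    | none => rfl
    | some a =>
      have h := congrArg (fun e => e (a, b)) hw
      rw [← sub_eq_zero]
      refine Eq.trans ?_ h
      simp only [S, Finset.sum_filter, ← Finset.sum_sub_distrib, WithLp.ofLp_sum, Finset.sum_apply]
      refine Finset.sum_congr rfl fun i _ => ?_
      cases s i with
      | none => simp [v, u]
      | some j => by_cases hj : j = a <;> simp [v, u, hj]
  have hweight (k : Option (Fin r)) : ∑ i with s i = k, w i = S none none := by
    simpa [S, y] using hS k none
  have hpos : 0 < S none none := by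
    have htotal : ∑ k, ∑ i with s i = k, w i = 1 := by rw [Finset.sum_fiberwise, hw1]
    simp only [hweight, Finset.sum_const, nsmul_eq_mul] at htotal
    by_contra! hle
    have := mul_nonpos_of_nonneg_of_nonpos
      (Nat.cast_nonneg (α := ℝ) (Finset.univ : Finset (Option (Fin r))).card) hle
    linarith
  refine ⟨s, fun b => (S none none)⁻¹ * S none (some b), fun k => ?_⟩
  have hmem := Finset.centerMass_mem_convexHull (R := ℝ) (s := x '' {i | s i = k})
    (Finset.univ.filter fun i => s i = k) (w := w) (z := x) (fun i _ => hw0 i)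
    (by rwa [hweight]) fun i hi => ⟨i, by simpa using hi, rfl⟩
  convert hmem using 1
  ext b
  rw [Finset.centerMass, hweight, ← hS k (some b)]
  simp [S, y]

/-- **Tverberg's theorem (1966).** For `d ≥ 1` and `q ≥ 1`, any set of
`(q - 1)(d + 1) + 1` points in `ℝ^d` can be partitioned into `q` (pairwise disjoint,
nonempty) subsets such that the convex hulls of all `q` subsets have a point in
common. -/
theorem tverberg_theorem {d q : ℕ} (hd : 1 ≤ d) (hq : 1 ≤ q)
    (X : Finset (Fin d → ℝ)) (hX : X.card = (q - 1) * (d + 1) + 1) :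
    ∃ P : Finset (Finset (Fin d → ℝ)),
      P.card = q ∧
      (∀ F ∈ P, F.Nonempty) ∧
      (∀ F ∈ P, ∀ G ∈ P, F ≠ G → Disjoint F G) ∧
      (∀ x, x ∈ X ↔ ∃ F ∈ P, x ∈ F) ∧
      ∃ p : Fin d → ℝ, ∀ F ∈ P, p ∈ convexHull ℝ (F : Set (Fin d → ℝ)) := by
  classical
  obtain ⟨r, rfl⟩ := Nat.exists_eq_add_of_le' hq
  obtain ⟨s, p, hp⟩ := exists_coloring_forall_mem_convexHull (r := r)
    (fun x : X => (x : Fin d → ℝ)) (by simpa using hX)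
  let F (k : Option (Fin r)) : Finset (Fin d → ℝ) :=
    (Finset.univ.filter fun x : X => s x = k).image Subtype.val
  have hmem (k : Option (Fin r)) (x : Fin d → ℝ) : x ∈ F k ↔ ∃ hx : x ∈ X, s ⟨x, hx⟩ = k := by
    simp [F]
  have hcoe (k : Option (Fin r)) :
      (F k : Set (Fin d → ℝ)) = (fun x : X => (x : Fin d → ℝ)) '' {x | s x = k} := by
    simp [F]
  have hhull (k : Option (Fin r)) : p ∈ convexHull ℝ (F k : Set (Fin d → ℝ)) := hcoe k ▸ hp k
  have hne (k : Option (Fin r)) : (F k).Nonempty :=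
    Finset.coe_nonempty.1 (convexHull_nonempty_iff.1 ⟨p, hhull k⟩)
  have hdisj {k l : Option (Fin r)} (hkl : k ≠ l) : Disjoint (F k) (F l) := by
    refine Finset.disjoint_left.2 fun x hk hl => hkl ?_
    obtain ⟨_, rfl⟩ := (hmem k x).1 hk
    obtain ⟨_, rfl⟩ := (hmem l x).1 hl
    rfl
  have hinj : Function.Injective F := by
    intro k l hkl
    by_contra h
    have hself := hdisj h
    rw [← hkl, Finset.disjoint_self_iff_empty] at hself
    exact (hne k).ne_empty hself
  refine ⟨Finset.univ.image F, ?_, ?_, ?_, ?_, p, ?_⟩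
  · simp [Finset.card_image_of_injective _ hinj]
  · simpa using hne
  · simp only [Finset.mem_image, Finset.mem_univ, true_and]
    rintro _ ⟨k, rfl⟩ _ ⟨l, rfl⟩ h
    exact hdisj fun hkl => h (congrArg F hkl)
  · simp [hmem]
  · simpa using hhull
end

section
/- Let q = p^r be a prime power, d ≥ 1, and N = (d+1)(q−1). For any continuous map f from the standard N-dimensional simplex to ℝ^d, the number of unordered q-tuples {F_1, …, F_q} of pairwise disjoint faces of the N-simplex such that the images f(F_1), …, f(F_q) have a point in common is at least (1/(q−1)!)·(q/(r+1))^⌈N/2⌉. -/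
/-- The face of the standard simplex `σ^N ⊆ ℝ^{N+1}` spanned by the vertices (standard
basis vectors) indexed by the nonempty subset `s`: the convex hull of those vertices. -/
def simplexFace {n : ℕ} (s : Finset (Fin n)) : Set (Fin n → ℝ) :=
  convexHull ℝ ((fun i => Pi.single i (1 : ℝ)) '' (↑s : Set (Fin n)))

namespace Tverberg

open Finsupp

section Chains

variable {k α β : Type*} [Field k]

/-- Two linear maps that agree on the lists of `s` agree on all chains supported in `s`. -/
lemma eq_of_mem_supported {ι M : Type*} [AddCommGroup M] [Module k M] {f g : (ι →₀ k) →ₗ[k] M}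
    {s : Set ι} (h : ∀ l ∈ s, f (single l 1) = g (single l 1)) {c : ι →₀ k}
    (hc : c ∈ supported k k s) : f c = g c := by
  rw [supported_eq_span_single] at hc
  refine LinearMap.eqOn_span (s := (fun i => single i (1 : k)) '' s) ?_ hc
  rintro _ ⟨l, hl, rfl⟩
  exact h l hl

/-- A linear map sends chains supported in `s` into `S` as soon as it does so for lists. -/
lemma map_mem_of_mem_supported {ι M : Type*} [AddCommGroup M] [Module k M]
    {f : (ι →₀ k) →ₗ[k] M} {s : Set ι} {S : Submodule k M}
    (h : ∀ l ∈ s, f (single l 1) ∈ S) {c : ι →₀ k} (hc : c ∈ supported k k s) : f c ∈ S := by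
  rw [supported_eq_span_single] at hc
  have : Submodule.span k ((fun i => single i (1 : k)) '' s) ≤ S.comap f := by
    rw [Submodule.span_le]
    rintro _ ⟨l, hl, rfl⟩
    exact h l hl
  exact this hc

/-- Prepending a vertex to every list of a chain. -/
noncomputable def cone (a : α) : (List α →₀ k) →ₗ[k] (List α →₀ k) :=
  lmapDomain k k (List.cons a)

@[simp] lemma cone_single (a : α) (l : List α) (x : k) :
    cone a (single l x) = single (a :: l) x := by
  simp [cone]

/-- The boundary of a single list. -/
noncomputable def bdryList (k : Type*) [Field k] : List α → (List α →₀ k)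
  | [] => 0
  | a :: l => single l 1 - cone a (bdryList k l)

/-- The augmented boundary operator of ordered chains; lists of length `n` have dimension
`n - 1`. -/
noncomputable def bdry : (List α →₀ k) →ₗ[k] (List α →₀ k) :=
  linearCombination k (bdryList k)

lemma bdry_nil (x : k) : bdry (single ([] : List α) x) = 0 := by
  simp [bdry, bdryList]

lemma bdry_cone (a : α) (c : List α →₀ k) : bdry (cone a c) = c - cone a (bdry c) := by
  have : bdry ∘ₗ cone a = LinearMap.id - cone a ∘ₗ (bdry : (List α →₀ k) →ₗ[k] _) := by
    ext l : 2
    simp [bdry, bdryList]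
  exact LinearMap.congr_fun this c

lemma bdry_cons (a : α) (l : List α) :
    bdry (single (a :: l) (1 : k)) = single l 1 - cone a (bdry (single l 1)) := by
  rw [← bdry_cone, cone_single]

lemma bdry_bdry (c : List α →₀ k) : bdry (bdry c) = 0 := by
  have : bdry ∘ₗ bdry = (0 : (List α →₀ k) →ₗ[k] _) := by
    ext l : 2
    simp only [LinearMap.comp_apply, lsingle_apply, LinearMap.zero_apply]
    induction l with
    | nil => simp [bdry_nil]
    | cons a l ih => simp [bdry_cons, bdry_cone, ih]
  exact LinearMap.congr_fun this c

/-- The lists of `U` of length `n`. -/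
def graded (U : Set (List α)) (n : ℕ) : Set (List α) := {l | l ∈ U ∧ l.length = n}

lemma bdry_single_mem (l : List α) :
    bdry (single l (1 : k)) ∈ supported k k {l' | l'.Sublist l ∧ l'.length + 1 = l.length} := by
  induction l with
  | nil => simp [bdry_nil]
  | cons a l ih =>
    rw [bdry_cons]
    refine Submodule.sub_mem _ (single_mem_supported _ _ (by simp)) ?_
    refine map_mem_of_mem_supported ?_ ih
    rintro l' ⟨h1, h2⟩
    rw [cone_single]
    exact single_mem_supported _ _ ⟨h1.cons_cons a, by simp [h2]⟩

/-- Closure under sublists, as for the faces of a simplicial complex. -/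
def SublistClosed (U : Set (List α)) : Prop := ∀ l ∈ U, ∀ l' : List α, l'.Sublist l → l' ∈ U

lemma bdry_mem_graded {U : Set (List α)} (hU : SublistClosed U) {n : ℕ} {c : List α →₀ k}
    (hc : c ∈ supported k k (graded U (n + 1))) : bdry c ∈ supported k k (graded U n) := by
  refine map_mem_of_mem_supported ?_ hc
  rintro l ⟨h1, h2⟩
  refine supported_mono ?_ (bdry_single_mem l)
  rintro l' ⟨h3, h4⟩
  exact ⟨hU l h1 l' h3, by omega⟩

lemma bdry_graded_zero {U : Set (List α)} {c : List α →₀ k}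
    (hc : c ∈ supported k k (graded U 0)) : bdry c = 0 := by
  have : bdry c = (0 : (List α →₀ k) →ₗ[k] (List α →₀ k)) c := by
    refine eq_of_mem_supported ?_ hc
    rintro l ⟨h1, h2⟩
    rw [List.eq_nil_of_length_eq_zero h2]
    simp [bdry_nil]
  simpa using this

/-- Concatenation of chains. -/
noncomputable def app : (List α →₀ k) →ₗ[k] (List α →₀ k) →ₗ[k] (List α →₀ k) :=
  linearCombination k fun l => lmapDomain k k (l ++ ·)

@[simp] lemma app_single (l l' : List α) (x y : k) :
    app (single l x) (single l' y) = single (l ++ l') (x * y) := by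
  simp [app]

/-- The sign operator: multiplication by `(-1) ^ n` on lists of length `n`. -/
noncomputable def sgn : (List α →₀ k) →ₗ[k] (List α →₀ k) :=
  linearCombination k fun l => single l ((-1) ^ l.length)

lemma sgn_single (l : List α) : sgn (single l (1 : k)) = (-1 : k) ^ l.length • single l 1 := by
  simp [sgn]

lemma sgn_of_mem {U : Set (List α)} {n : ℕ} {c : List α →₀ k}
    (hc : c ∈ supported k k (graded U n)) : sgn c = (-1 : k) ^ n • c := by
  have : sgn c = ((-1 : k) ^ n • (LinearMap.id : (List α →₀ k) →ₗ[k] (List α →₀ k))) c := by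
    refine eq_of_mem_supported ?_ hc
    rintro l ⟨h1, h2⟩
    simp [sgn, h2]
  simpa using this

lemma sgn_cone (a : α) (c : List α →₀ k) : sgn (cone a c) = -cone a (sgn c) := by
  have : sgn ∘ₗ cone a = -(cone a ∘ₗ (sgn : (List α →₀ k) →ₗ[k] _)) := by
    ext l : 2
    simp [sgn, pow_succ]
  exact LinearMap.congr_fun this c

lemma sgn_sgn (c : List α →₀ k) : sgn (sgn c) = c := by
  have : sgn ∘ₗ sgn = (LinearMap.id : (List α →₀ k) →ₗ[k] _) := by
    ext l : 2
    simp [sgn, ← mul_pow]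
  exact LinearMap.congr_fun this c

lemma sgn_bdry (c : List α →₀ k) : sgn (bdry c) = -bdry (sgn c) := by
  have : sgn ∘ₗ bdry = -(bdry ∘ₗ (sgn : (List α →₀ k) →ₗ[k] _)) := by
    ext l : 2
    simp only [LinearMap.comp_apply, lsingle_apply, LinearMap.neg_apply]
    induction l with
    | nil => simp [bdry_nil, sgn_single]
    | cons a l ih =>
      rw [← cone_single, bdry_cone, map_sub, sgn_cone, sgn_cone, ih, map_neg, map_neg, bdry_cone]
      abel
  exact LinearMap.congr_fun this c

lemma app_cone (a : α) (x y : List α →₀ k) : app (cone a x) y = cone a (app x y) := by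
  have : app ∘ₗ cone a = LinearMap.compr₂ (app : (List α →₀ k) →ₗ[k] _ →ₗ[k] _) (cone a) := by
    ext l l' : 4
    simp
  exact LinearMap.congr_fun₂ this x y

lemma nil_app (y : List α →₀ k) : app (single [] 1) y = y := by
  have : app (single [] 1) = (LinearMap.id : (List α →₀ k) →ₗ[k] _) := by
    ext l : 2
    simp
  exact LinearMap.congr_fun this y

lemma bdry_app (x y : List α →₀ k) :
    bdry (app x y) = app (bdry x) y + app (sgn x) (bdry y) := by
  have : bdry ∘ₗ app.flip y = app.flip y ∘ₗ bdry + app.flip (bdry y) ∘ₗ sgn := by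
    ext l : 2
    simp only [LinearMap.comp_apply, lsingle_apply, LinearMap.add_apply, LinearMap.flip_apply]
    induction l with
    | nil => simp [bdry_nil, sgn_single, nil_app]
    | cons a l ih =>
      rw [← cone_single, app_cone, bdry_cone, bdry_cone, sgn_cone, ih]
      simp only [map_sub, map_neg, LinearMap.sub_apply, LinearMap.neg_apply, app_cone, map_add]
      abel
  exact LinearMap.congr_fun this x

lemma app_mem {U W : Set (List α)} {m n : ℕ} {x y : List α →₀ k}
    (hx : x ∈ supported k k (graded U m)) (hy : y ∈ supported k k (graded W n)) :
    app x y ∈ supported k k (graded (Set.image2 (· ++ ·) U W) (m + n)) := by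
  have key : ∀ l ∈ graded U m,
      app (single l 1) y ∈ supported k k (graded (Set.image2 (· ++ ·) U W) (m + n)) := by
    rintro l ⟨hl, rfl⟩
    refine map_mem_of_mem_supported ?_ hy
    rintro l' ⟨hl', rfl⟩
    rw [app_single]
    exact single_mem_supported _ _ ⟨⟨l, hl, l', hl', rfl⟩, by simp⟩
  exact map_mem_of_mem_supported (f := app.flip y) key hx

end Chains

section Join

variable {k α : Type*} [Field k]

/-- A linear contraction of the chains on `U` below length `a`; it witnesses the vanishing of the
reduced homology of the complex `U` below dimension `a - 1`. -/
def Contractible (k : Type*) [Field k] (U : Set (List α)) (a : ℕ) : Prop :=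
  ∃ h : (List α →₀ k) →ₗ[k] (List α →₀ k),
    (∀ n, ∀ c ∈ supported k k (graded U n), h c ∈ supported k k (graded U (n + 1))) ∧
    ∀ n < a, ∀ c ∈ supported k k (graded U n), bdry (h c) + h (bdry c) = c

lemma supported_graded_le (U : Set (List α)) (n : ℕ) :
    supported k k (graded U n) ≤ supported k k U :=
  supported_mono fun _ hl => hl.1

lemma SublistClosed.bdry_mem {U : Set (List α)} (hU : SublistClosed U) {c : List α →₀ k}
    (hc : c ∈ supported k k U) : bdry c ∈ supported k k U := by
  refine map_mem_of_mem_supported ?_ hc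
  intro l hl
  exact supported_mono (fun l' hl' => hU l hl l' hl'.1) (bdry_single_mem l)

lemma sgn_mem {U : Set (List α)} {c : List α →₀ k} (hc : c ∈ supported k k U) :
    sgn c ∈ supported k k U := by
  refine map_mem_of_mem_supported ?_ hc
  intro l hl
  rw [sgn_single]
  exact Submodule.smul_mem _ _ (single_mem_supported _ _ hl)

lemma sgn_comp_of_degree_one {U : Set (List α)} {h : (List α →₀ k) →ₗ[k] (List α →₀ k)}
    (hh : ∀ n, ∀ c ∈ supported k k (graded U n), h c ∈ supported k k (graded U (n + 1)))
    {c : List α →₀ k} (hc : c ∈ supported k k U) : sgn (h c) = -h (sgn c) := by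
  have : (sgn ∘ₗ h) c = (-(h ∘ₗ sgn)) c := by
    refine eq_of_mem_supported ?_ hc
    intro l hl
    have hl' : single l (1 : k) ∈ supported k k (graded U l.length) :=
      single_mem_supported _ _ ⟨hl, rfl⟩
    simp only [LinearMap.comp_apply, LinearMap.neg_apply]
    rw [sgn_of_mem (hh _ _ hl'), sgn_of_mem hl']
    rw [map_smul, pow_succ, mul_neg_one, neg_smul]
  exact this

/-- The join of two complexes on disjoint vertex sets. -/
theorem Contractible.join {U W : Set (List α)} {a b : ℕ} (hU : Contractible k U a)
    (hW : Contractible k W b) (cU : SublistClosed U) (cW : SublistClosed W) (S : Set α)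
    (sU : ∀ l ∈ U, ∀ x ∈ l, x ∈ S) (sW : ∀ l ∈ W, ∀ x ∈ l, x ∉ S) :
    Contractible k (Set.image2 (· ++ ·) U W) (a + b) := by
  classical
  obtain ⟨h, h1, h2⟩ := hU
  obtain ⟨g, g1, g2⟩ := hW
  set π : (List α →₀ k) →ₗ[k] (List α →₀ k) := LinearMap.id - bdry ∘ₗ h - h ∘ₗ bdry with hπ
  have π_apply (x) : π x = x - bdry (h x) - h (bdry x) := rfl
  let left (l : List α) : List α →₀ k := single (l.filter (· ∈ S)) 1
  let right (l : List α) : List α →₀ k := single (l.filter (· ∉ S)) 1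
  let H : (List α →₀ k) →ₗ[k] (List α →₀ k) := linearCombination k fun l =>
    app (h (left l)) (right l) + app (π (sgn (left l))) (g (right l))
  have hleft {l₁ l₂} (hl₁ : l₁ ∈ U) (hl₂ : l₂ ∈ W) : left (l₁ ++ l₂) = single l₁ 1 := by
    simp only [left, List.filter_append]
    rw [List.filter_eq_self.2 (by simpa using sU l₁ hl₁),
      List.filter_eq_nil_iff.2 (by simpa using sW l₂ hl₂), List.append_nil]
  have hright {l₁ l₂} (hl₁ : l₁ ∈ U) (hl₂ : l₂ ∈ W) : right (l₁ ++ l₂) = single l₂ 1 := by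
    simp only [right, List.filter_append]
    rw [List.filter_eq_nil_iff.2 (by simpa using sU l₁ hl₁),
      List.filter_eq_self.2 (by simpa using sW l₂ hl₂), List.nil_append]
  have H_app {x y} (hx : x ∈ supported k k U) (hy : y ∈ supported k k W) :
      H (app x y) = app (h x) y + app (π (sgn x)) (g y) := by
    have e1 : ∀ l₁ ∈ U, H (app (single l₁ 1) y)
        = app (h (single l₁ 1)) y + app (π (sgn (single l₁ 1))) (g y) := by
      intro l₁ hl₁
      refine eq_of_mem_supported (f := H ∘ₗ app (single l₁ 1))
        (g := app (h (single l₁ 1)) + app (π (sgn (single l₁ 1))) ∘ₗ g) ?_ hy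
      intro l₂ hl₂
      simp only [LinearMap.comp_apply, app_single, H, linearCombination_single, hleft hl₁ hl₂,
        hright hl₁ hl₂, LinearMap.add_apply, mul_one, one_smul]
    refine eq_of_mem_supported (f := H ∘ₗ app.flip y)
        (g := app.flip y ∘ₗ h + app.flip (g y) ∘ₗ π ∘ₗ sgn) ?_ hx
    intro l₁ hl₁
    exact e1 l₁ hl₁
  have hπgr {n x} (hx : x ∈ supported k k (graded U n)) : π x ∈ supported k k (graded U n) := by
    rw [π_apply]
    refine Submodule.sub_mem _ (Submodule.sub_mem _ hx (bdry_mem_graded cU (h1 _ _ hx))) ?_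
    cases n with
    | zero => rw [bdry_graded_zero hx, map_zero]; exact Submodule.zero_mem _
    | succ n => exact h1 _ _ (bdry_mem_graded cU hx)
  have key {x y} (hx : x ∈ supported k k U) (hy : y ∈ supported k k W) :
      bdry (H (app x y)) + H (bdry (app x y))
        = app (bdry (h x) + h (bdry x)) y + app (π x) (bdry (g y) + g (bdry y)) := by
    have bx := cU.bdry_mem hx
    have sx := sgn_mem hx
    have by' := cW.bdry_mem hy
    have sπ : sgn (π (sgn x)) = π x := by
      simp only [π_apply, map_sub, sgn_bdry, sgn_comp_of_degree_one h1 sx, sgn_sgn,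
        sgn_comp_of_degree_one h1 (cU.bdry_mem sx), map_neg, neg_neg]
    have bπ : bdry (π (sgn x)) = -π (sgn (bdry x)) := by
      simp only [π_apply, map_sub, sgn_bdry, map_neg, bdry_bdry, map_zero]
      abel
    rw [bdry_app, map_add, H_app hx hy, H_app bx hy, H_app sx by', map_add, bdry_app, bdry_app,
      sπ, bπ, sgn_comp_of_degree_one h1 hx, sgn_sgn]
    simp only [map_neg, LinearMap.neg_apply, map_add, LinearMap.add_apply]
    abel
  refine ⟨H, ?_, ?_⟩
  · intro n c hc
    refine map_mem_of_mem_supported ?_ hc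
    rintro _ ⟨⟨l₁, hl₁, l₂, hl₂, rfl⟩, rfl⟩
    have m1 : single l₁ (1 : k) ∈ supported k k (graded U l₁.length) :=
      single_mem_supported _ _ ⟨hl₁, rfl⟩
    have m2 : single l₂ (1 : k) ∈ supported k k (graded W l₂.length) :=
      single_mem_supported _ _ ⟨hl₂, rfl⟩
    have e : single (l₁ ++ l₂) (1 : k) = app (single l₁ 1) (single l₂ 1) := by simp
    simp only
    rw [e, H_app (supported_graded_le _ _ m1) (supported_graded_le _ _ m2)]
    refine Submodule.add_mem _ ?_ ?_
    · have := app_mem (h1 _ _ m1) m2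
      rwa [show l₁.length + 1 + l₂.length = (l₁ ++ l₂).length + 1 by simp; omega] at this
    · rw [sgn_single, map_smul, map_smul, LinearMap.smul_apply]
      refine Submodule.smul_mem _ _ ?_
      have := app_mem (hπgr m1) (g1 _ _ m2)
      rwa [show l₁.length + (l₂.length + 1) = (l₁ ++ l₂).length + 1 by simp; omega] at this
  · intro n hn c hc
    refine eq_of_mem_supported (f := bdry ∘ₗ H + H ∘ₗ bdry) (g := LinearMap.id) ?_ hc
    rintro _ ⟨⟨l₁, hl₁, l₂, hl₂, rfl⟩, hlen⟩
    have m1 : single l₁ (1 : k) ∈ supported k k (graded U l₁.length) :=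
      single_mem_supported _ _ ⟨hl₁, rfl⟩
    have m2 : single l₂ (1 : k) ∈ supported k k (graded W l₂.length) :=
      single_mem_supported _ _ ⟨hl₂, rfl⟩
    have e : single (l₁ ++ l₂) (1 : k) = app (single l₁ 1) (single l₂ 1) := by simp
    simp only [LinearMap.add_apply, LinearMap.comp_apply, LinearMap.id_apply]
    rw [e, key (supported_graded_le _ _ m1) (supported_graded_le _ _ m2)]
    simp only [List.length_append] at hlen
    by_cases hlt : l₁.length < a
    · have := h2 _ hlt _ m1
      have h0 : π (single l₁ 1) = 0 := by rw [π_apply, sub_sub, this, sub_self]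
      rw [this, h0]
      simp
    · rw [g2 _ (by omega) _ m2, π_apply]
      simp only [map_add, map_sub, LinearMap.add_apply, LinearMap.sub_apply]
      abel

lemma contractible_nil : Contractible k ({[]} : Set (List α)) 0 :=
  ⟨0, fun _ _ _ => by simp, fun n hn => by omega⟩

/-- A connected graph has vanishing reduced homology below dimension one. -/
lemma contractible_of_connected {U : Set (List α)} (v₀ : α) (hv₀ : [v₀] ∈ U)
    (hconn : ∀ l ∈ graded U 1, ∃ c ∈ supported k k (graded U 2),
      bdry c = single l 1 - single [v₀] 1) : Contractible k U 2 := by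
  classical
  choose! P hP hbP using hconn
  let h : (List α →₀ k) →ₗ[k] (List α →₀ k) := linearCombination k fun l =>
    if l = [] then single [v₀] 1 else if l ∈ graded U 1 then P l else 0
  have h_nil : h (single [] 1) = single [v₀] 1 := by simp [h]
  have h_one {l} (hl : l ∈ graded U 1) : h (single l 1) = P l := by
    have : l ≠ [] := by rintro rfl; simp [graded] at hl
    simp [h, this, hl]
  have h_big {l : List α} (hl : 2 ≤ l.length) : h (single l 1) = 0 := by
    have h1 : l ≠ [] := by rintro rfl; simp at hl
    have h2 : l ∉ graded U 1 := fun hl' => by have := hl'.2; omega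
    simp [h, h1, h2]
  refine ⟨h, fun n c hc => map_mem_of_mem_supported ?_ hc, fun n hn c hc => ?_⟩
  · rintro l ⟨hl, rfl⟩
    rcases Nat.lt_trichotomy l.length 1 with h0 | h1 | h2
    · obtain rfl : l = [] := List.eq_nil_of_length_eq_zero (by omega)
      rw [h_nil]
      exact single_mem_supported _ _ ⟨hv₀, rfl⟩
    · rw [h_one ⟨hl, h1⟩, h1]
      exact hP l ⟨hl, h1⟩
    · rw [h_big h2]
      exact Submodule.zero_mem _
  · refine eq_of_mem_supported (f := bdry ∘ₗ h + h ∘ₗ bdry) (g := LinearMap.id) ?_ hc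
    rintro l ⟨hl, rfl⟩
    simp only [LinearMap.add_apply, LinearMap.comp_apply, LinearMap.id_apply]
    rcases Nat.lt_or_ge l.length 1 with h0 | h1
    · obtain rfl : l = [] := List.eq_nil_of_length_eq_zero (by omega)
      rw [h_nil, bdry_cons, bdry_nil]
      simp
    · have h1 : l.length = 1 := by omega
      rw [h_one ⟨hl, h1⟩, hbP _ ⟨hl, h1⟩]
      obtain ⟨v, rfl⟩ := List.length_eq_one_iff.1 h1
      rw [bdry_cons, bdry_nil, map_zero, sub_zero, h_nil, sub_add_cancel]

/-- A nonempty complex has vanishing reduced homology in dimension `-1`. -/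
lemma contractible_of_nonempty {U : Set (List α)} (v₀ : α) (hv₀ : [v₀] ∈ U) :
    Contractible k U 1 := by
  classical
  let h : (List α →₀ k) →ₗ[k] (List α →₀ k) := linearCombination k fun l =>
    if l = [] then single [v₀] 1 else 0
  refine ⟨h, fun n c hc => map_mem_of_mem_supported ?_ hc, fun n hn c hc => ?_⟩
  · rintro l ⟨hl, rfl⟩
    by_cases h0 : l = []
    · subst h0
      simpa [h] using single_mem_supported k (1 : k) (show [v₀] ∈ graded U 1 from ⟨hv₀, rfl⟩)
    · simp [h, h0]
  · refine eq_of_mem_supported (f := bdry ∘ₗ h + h ∘ₗ bdry) (g := LinearMap.id) ?_ hc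
    rintro l ⟨hl, rfl⟩
    obtain rfl : l = [] := List.eq_nil_of_length_eq_zero (by omega)
    simp [h, bdry_cons, bdry_nil]

end Join

section JoinOfFactors

variable {k α : Type*} [Field k]

/-- The join of the complexes `F 0, …, F (m - 1)`. -/
def joinFactors (F : ℕ → Set (List α)) : ℕ → Set (List α)
  | 0 => {[]}
  | m + 1 => Set.image2 (· ++ ·) (joinFactors F m) (F m)

lemma joinFactors_sublistClosed {F : ℕ → Set (List α)} (hF : ∀ j, SublistClosed (F j)) (m : ℕ) :
    SublistClosed (joinFactors F m) := by
  induction m with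
  | zero =>
    rintro l rfl l' hl'
    exact List.sublist_nil.1 hl'
  | succ m ih =>
    rintro _ ⟨l₁, hl₁, l₂, hl₂, rfl⟩ l' hl'
    obtain ⟨r₁, r₂, rfl, h₁, h₂⟩ := List.sublist_append_iff.1 hl'
    exact ⟨r₁, ih _ hl₁ _ h₁, r₂, hF m _ hl₂ _ h₂, rfl⟩

lemma joinFactors_color {F : ℕ → Set (List α)} {color : α → ℕ}
    (hF : ∀ j, ∀ l ∈ F j, ∀ x ∈ l, color x = j) (m : ℕ) :
    ∀ l ∈ joinFactors F m, ∀ x ∈ l, color x < m := by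
  induction m with
  | zero =>
    rintro l rfl x hx
    simp at hx
  | succ m ih =>
    rintro _ ⟨l₁, hl₁, l₂, hl₂, rfl⟩ x hx
    rcases List.mem_append.1 hx with hx | hx
    · exact (ih _ hl₁ x hx).trans (Nat.lt_succ_self m)
    · exact (hF m _ hl₂ x hx).trans_lt (Nat.lt_succ_self m)

lemma contractible_joinFactors {F : ℕ → Set (List α)} {color : α → ℕ} {a : ℕ → ℕ}
    (hcl : ∀ j, SublistClosed (F j)) (hF : ∀ j, ∀ l ∈ F j, ∀ x ∈ l, color x = j) (m : ℕ)
    (ha : ∀ j < m, Contractible k (F j) (a j)) :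
    Contractible k (joinFactors F m) (∑ j ∈ Finset.range m, a j) := by
  induction m with
  | zero => simpa [joinFactors] using contractible_nil
  | succ m ih =>
    rw [Finset.sum_range_succ]
    refine (ih fun j hj => ha j (hj.trans (Nat.lt_succ_self m))).join (ha m (Nat.lt_succ_self m))
      (joinFactors_sublistClosed hcl m) (hcl m) {x | color x < m} (joinFactors_color hF m) ?_
    intro l hl x hx
    simp [hF m l hl x hx]

end JoinOfFactors

section Configuration

variable {k G : Type*} [Field k] [AddCommGroup G] {n : ℕ}

/-- The graph on the vertices `2 * j` and `2 * j + 1` (each with `|G|` copies), whose edges are given by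
the differences in `E j`; lists are ordered by the first coordinate. -/
def factor (n : ℕ) (E : ℕ → Set G) (j : ℕ) : Set (List (Fin n × G)) :=
  {l | (∀ x ∈ l, (x.1 : ℕ) / 2 = j) ∧ l.Pairwise fun x y => x.1 < y.1 ∧ y.2 - x.2 ∈ E j}

lemma factor_sublistClosed (E : ℕ → Set G) (j : ℕ) : SublistClosed (factor n E j) :=
  fun _ hl _ hl' => ⟨fun x hx => hl.1 x (hl'.subset hx), hl.2.sublist hl'⟩

lemma contractible_factor {E : ℕ → Set G} {j : ℕ} (hj : 2 * j + 1 < n) (hne : (E j).Nonempty)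
    (hE : ∀ H : AddSubgroup G, (∀ e ∈ E j, ∀ e' ∈ E j, e - e' ∈ H) → H = ⊤) :
    Contractible k (factor n E j) 2 := by
  let u : Fin n := ⟨2 * j, by omega⟩
  let v : Fin n := ⟨2 * j + 1, hj⟩
  let reach (x y : Fin n × G) : Prop := ∃ c ∈ supported k k (graded (factor n E j) 2),
    bdry c = single [x] 1 - single [y] 1
  have refl (x) : reach x x := ⟨0, Submodule.zero_mem _, by simp⟩
  have symm {x y} : reach x y → reach y x := fun ⟨c, hc, h⟩ =>
    ⟨-c, Submodule.neg_mem _ hc, by rw [map_neg, h, neg_sub]⟩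
  have trans {x y z} : reach x y → reach y z → reach x z := fun ⟨c, hc, h⟩ ⟨c', hc', h'⟩ =>
    ⟨c + c', Submodule.add_mem _ hc hc', by rw [map_add, h, h', sub_add_sub_cancel]⟩
  have edge {x y : G} (h : y - x ∈ E j) : reach (v, y) (u, x) := by
    refine ⟨single [(u, x), (v, y)] 1, single_mem_supported _ _ ⟨⟨?_, ?_⟩, rfl⟩, ?_⟩
    · intro w hw
      simp only [List.mem_cons, List.not_mem_nil, or_false] at hw
      rcases hw with rfl | rfl <;> simp [u, v]; omega
    · simpa [u, v] using h
    · simp [bdry_cons, bdry_nil]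
  let H : AddSubgroup G :=
    { carrier := {g | ∀ x, reach (u, x + g) (u, x)}
      zero_mem' := fun x => by simpa using refl _
      add_mem' := fun {g g'} hg hg' x => trans (by rw [← add_assoc]; exact hg' _) (hg x)
      neg_mem' := fun {g} hg x => symm (by simpa using hg (x + -g)) }
  have hH : H = ⊤ := hE H fun e he e' he' x =>
    trans (symm (edge (y := x + e) (by simpa using he'))) (edge (by simpa using he))
  have hu (x : G) : reach (u, x) (u, 0) := by
    have : x ∈ H := by rw [hH]; trivial
    simpa using this 0
  obtain ⟨e, he⟩ := hne
  refine contractible_of_connected (u, 0) ⟨by simp [u], by simp⟩ ?_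
  rintro l ⟨hl, hlen⟩
  obtain ⟨⟨w, x⟩, rfl⟩ := List.length_eq_one_iff.1 hlen
  have hw : (w : ℕ) / 2 = j := hl.1 (w, x) (by simp)
  rcases Nat.even_or_odd' (w : ℕ) with ⟨i, hi | hi⟩
  · obtain rfl : w = u := Fin.ext (by simp only [u]; omega)
    exact hu x
  · obtain rfl : w = v := Fin.ext (by simp only [v]; omega)
    exact trans (edge (x := x - e) (by simpa using he)) (hu _)

/-- The configuration complex: the join of all factors. -/
def config (n : ℕ) (E : ℕ → Set G) : Set (List (Fin n × G)) :=
  joinFactors (factor n E) ((n + 1) / 2)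

lemma factor_nil_mem (E : ℕ → Set G) (j : ℕ) : [] ∈ factor n E j := by
  simp [factor]

lemma config_nil_mem (E : ℕ → Set G) : [] ∈ config n E := by
  unfold config
  generalize (n + 1) / 2 = m
  induction m with
  | zero => simp [joinFactors]
  | succ m ih => exact ⟨[], ih, [], factor_nil_mem E m, rfl⟩

theorem contractible_config {E : ℕ → Set G} (hne : ∀ j, (E j).Nonempty)
    (hE : ∀ j, ∀ H : AddSubgroup G, (∀ e ∈ E j, ∀ e' ∈ E j, e - e' ∈ H) → H = ⊤) :
    Contractible k (config n E) n := by
  have hcol : ∀ j, ∀ l ∈ factor n E j, ∀ x ∈ l, (x.1 : ℕ) / 2 = j := fun j l hl => hl.1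
  have key := contractible_joinFactors (k := k) (a := fun j => if 2 * j + 1 < n then 2 else 1)
    (factor_sublistClosed E) hcol ((n + 1) / 2) fun j hj => by
      split_ifs with h
      · exact contractible_factor h (hne j) (hE j)
      · exact contractible_of_nonempty (⟨2 * j, by omega⟩, 0) ⟨by simp, by simp⟩
  have hsum : ∑ j ∈ Finset.range ((n + 1) / 2), (if 2 * j + 1 < n then 2 else 1) = n := by
    have hev : ∑ j ∈ Finset.range (n / 2), (if 2 * j + 1 < n then 2 else 1) = n / 2 * 2 := by
      rw [Finset.sum_congr rfl fun j hj => if_pos (by have := Finset.mem_range.1 hj; omega)]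
      simp
    rcases Nat.even_or_odd' n with ⟨m, hm | hm⟩
    · rw [show (n + 1) / 2 = n / 2 by omega, hev]
      omega
    · rw [show (n + 1) / 2 = n / 2 + 1 by omega, Finset.sum_range_succ, hev, if_neg (by omega)]
      omega
  rwa [hsum] at key

lemma factor_exists_facet {E : ℕ → Set G} {j : ℕ} (hne : (E j).Nonempty)
    {l : List (Fin n × G)} (hl : l ∈ factor n E j) :
    ∃ ψ : Fin n → G, (∀ u v : Fin n, u < v → (u : ℕ) / 2 = j → (v : ℕ) / 2 = j →
      ψ v - ψ u ∈ E j) ∧ ∀ x ∈ l, ψ x.1 = x.2 := by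
  obtain ⟨e, he⟩ := hne
  obtain ⟨h1, h2⟩ := hl
  match l with
  | [] =>
    refine ⟨fun v => if (v : ℕ) % 2 = 0 then 0 else e, fun u v huv hu hv => ?_, by simp⟩
    have : (u : ℕ) < v := huv
    beta_reduce
    rw [if_neg (by omega), if_pos (by omega), sub_zero]
    exact he
  | [x] =>
    have hx := h1 x (by simp)
    refine ⟨fun v => if v = x.1 then x.2 else if v < x.1 then x.2 - e else x.2 + e,
      fun u v huv hu hv => ?_, by simp⟩
    have huv' : (u : ℕ) < v := huv
    simp only [Fin.ext_iff, Fin.lt_def]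
    split_ifs <;> first | omega | simpa using he
  | x :: y :: l =>
    have hx := h1 x (by simp)
    have hy := h1 y (by simp)
    have hxy : x.1 < y.1 ∧ y.2 - x.2 ∈ E j := (List.pairwise_cons.1 h2).1 y (by simp)
    have hxy' : (x.1 : ℕ) < y.1 := hxy.1
    refine ⟨fun v => if v = x.1 then x.2 else y.2, fun u v huv hu hv => ?_, ?_⟩
    · have huv' : (u : ℕ) < v := huv
      simp only [Fin.ext_iff]
      rw [if_neg (by omega), if_pos (by omega)]
      exact hxy.2
    · intro z hz
      simp only [List.mem_cons] at hz
      rcases hz with rfl | rfl | hz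
      · simp
      · exact if_neg hxy.1.ne'
      · have h3 : (y.1 : ℕ) < z.1 :=
          ((List.pairwise_cons.1 (List.pairwise_cons.1 h2).2).1 z hz).1
        have hz' := h1 z (by simp [hz])
        omega

/-- The maximal faces of the configuration complex. -/
def IsFacet (E : ℕ → Set G) (φ : Fin n → G) : Prop :=
  ∀ u v : Fin n, u < v → (u : ℕ) / 2 = (v : ℕ) / 2 → φ v - φ u ∈ E ((u : ℕ) / 2)

lemma filter_mem_factor {E : ℕ → Set G} {m : ℕ} :
    ∀ l ∈ joinFactors (factor n E) m, ∀ j,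
      l.filter (fun x => (x.1 : ℕ) / 2 = j) ∈ factor n E j := by
  induction m with
  | zero =>
    rintro l rfl j
    simpa using factor_nil_mem E j
  | succ m ih =>
    rintro _ ⟨l₁, hl₁, l₂, hl₂, rfl⟩ j
    rw [List.filter_append]
    by_cases hj : j = m
    · subst hj
      have hlt := joinFactors_color (F := factor n E) (color := fun x => (x.1 : ℕ) / 2)
        (fun j l hl => hl.1) j l₁ hl₁
      rw [List.filter_eq_nil_iff.2 (by intro x hx; have := hlt x hx; simp; omega),
        List.filter_eq_self.2 (by intro x hx; simpa using hl₂.1 x hx)]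
      exact hl₂
    · rw [(List.filter_eq_nil_iff (l := l₂)).2
        (by intro x hx; have := hl₂.1 x hx; simp; omega), List.append_nil]
      exact ih l₁ hl₁ j

lemma config_exists_facet {E : ℕ → Set G} (hne : ∀ j, (E j).Nonempty)
    {l : List (Fin n × G)} (hl : l ∈ config n E) :
    ∃ φ : Fin n → G, IsFacet E φ ∧ ∀ x ∈ l, φ x.1 = x.2 := by
  choose ψ h1 h2 using fun j => factor_exists_facet (hne j) (filter_mem_factor l hl j)
  refine ⟨fun v => ψ ((v : ℕ) / 2) v, fun u v huv h => ?_, fun x hx => ?_⟩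
  · simp only [← h]
    exact h1 _ u v huv rfl h.symm
  · exact h2 _ x (by simp [hx])

end Configuration

section Shift

/-- The diagonal action on lists. -/
instance listAddAction {G α : Type*} [AddMonoid G] [AddAction G α] : AddAction G (List α) where
  vadd g l := l.map (g +ᵥ ·)
  zero_vadd l := by
    change l.map _ = l
    simp
  add_vadd g h l := by
    change l.map _ = (l.map _).map _
    simp [add_vadd, Function.comp_def]

lemma list_vadd_def {G α : Type*} [AddMonoid G] [AddAction G α] (g : G) (l : List α) :
    g +ᵥ l = l.map (g +ᵥ ·) := rfl

/-- Translation in the second coordinate. -/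
instance prodAddAction {G ι : Type*} [AddCommGroup G] : AddAction G (ι × G) where
  vadd g x := (x.1, g + x.2)
  zero_vadd x := by
    change (x.1, 0 + x.2) = x
    simp
  add_vadd g h x := by
    change (x.1, g + h + x.2) = (x.1, g + (h + x.2))
    rw [add_assoc]

lemma prod_vadd_def {G ι : Type*} [AddCommGroup G] (g : G) (x : ι × G) :
    g +ᵥ x = (x.1, g + x.2) := rfl

variable {k G ι S S' : Type*} [Field k] [AddCommGroup G] [AddAction G S] [AddAction G S']
  [Fintype ι]

/-- The permutation representation on finitely supported functions. -/
noncomputable def translate (k : Type*) [Field k] (S : Type*) [AddAction G S] (g : G) :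
    Module.End k (S →₀ k) :=
  lmapDomain k k (g +ᵥ ·)

@[simp] lemma translate_single (g : G) (s : S) (x : k) :
    translate k S g (single s x) = single (g +ᵥ s) x := by
  simp [translate]

lemma translate_mul (g h : G) : translate k S g * translate k S h = translate k S (g + h) := by
  ext s : 2
  simp [add_vadd]

lemma translate_zero : translate k S (0 : G) = 1 := by
  ext s : 2
  simp

lemma translate_pow (g : G) (n : ℕ) : translate k S g ^ n = translate k S (n • g) := by
  induction n with
  | zero => simp [translate_zero]
  | succ n ih => rw [pow_succ, ih, translate_mul, succ_nsmul]

lemma translate_commute (g h : G) : Commute (translate k S g) (translate k S h) := by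
  rw [commute_iff_eq, translate_mul, translate_mul, add_comm]

/-- The operator `∑ i, a i • (b i - 1)` in the group algebra; it generates a shifted cyclic
subgroup. -/
noncomputable def shift (S : Type*) [AddAction G S] (a : ι → k) (b : ι → G) :
    Module.End k (S →₀ k) :=
  ∑ i, a i • (translate k S (b i) - 1)

variable (a : ι → k) (b : ι → G)

lemma shift_apply (c : S →₀ k) : shift S a b c = ∑ i, a i • (translate k S (b i) c - c) := by
  simp [shift, LinearMap.sum_apply]

/-- Frobenius for a finite sum of commuting elements. -/
lemma sum_pow_prime {R : Type*} [Ring R] {p : ℕ} (hp : p.Prime) (hR : (p : R) = 0)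
    {κ : Type*} {x : κ → R} (hx : ∀ i j, Commute (x i) (x j)) (s : Finset κ) :
    (∑ i ∈ s, x i) ^ p = ∑ i ∈ s, x i ^ p := by
  classical
  induction s using Finset.induction_on with
  | empty => simp [hp.ne_zero]
  | insert i s hi ih =>
    rw [Finset.sum_insert hi, Finset.sum_insert hi,
      (Commute.sum_right _ _ _ fun j _ => hx i j).add_pow_prime_eq hp, ih, hR]
    simp

lemma natCast_end_eq_zero {p : ℕ} (hk : (p : k) = 0) (M : Type*) [AddCommGroup M] [Module k M] :
    ((p : ℕ) : Module.End k M) = 0 := by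
  rw [← map_natCast (algebraMap k (Module.End k M)), hk, map_zero]

lemma commute_sub_one {R : Type*} [Ring R] {x y : R} (h : Commute x y) :
    Commute (x - 1) (y - 1) :=
  (h.sub_left (Commute.one_left _)).sub_right (Commute.one_right _)

lemma sub_one_pow_prime {R : Type*} [Ring R] {p : ℕ} (hp : p.Prime) (hR : (p : R) = 0) {x : R}
    (hx : x ^ p = 1) : (x - 1) ^ p = 0 := by
  have h : (x - 1 + 1) ^ p = (x - 1) ^ p + 1 := by
    rw [(Commute.one_right (x - 1)).add_pow_prime_eq hp, hR]
    simp
  rw [sub_add_cancel, hx] at h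
  simpa using h

lemma shift_pow_prime {p : ℕ} (hp : p.Prime) (hk : (p : k) = 0) (hb : ∀ i, p • b i = 0) :
    shift S a b ^ p = 0 := by
  have hR := natCast_end_eq_zero hk (S →₀ k)
  have hc (i j) : Commute (a i • (translate k S (b i) - 1)) (a j • (translate k S (b j) - 1)) := by
    have h : Commute (translate k S (b i) - 1) (translate k S (b j) - 1) :=
      commute_sub_one (R := Module.End k (S →₀ k)) (translate_commute (b i) (b j))
    exact (h.smul_left _).smul_right _
  rw [shift, sum_pow_prime hp hR hc]
  refine Finset.sum_eq_zero fun i _ => ?_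
  have h1 : (translate k S (b i) - 1) ^ p = 0 :=
    sub_one_pow_prime (R := Module.End k (S →₀ k)) hp hR (by rw [translate_pow, hb, translate_zero])
  rw [smul_pow, h1, smul_zero]

/-- A linear map commuting with the group action commutes with powers of the shift operator. -/
lemma map_shift_pow {f : (S →₀ k) →ₗ[k] (S' →₀ k)}
    (hf : ∀ (g : G) (c), f (translate k S g c) = translate k S' g (f c)) (n : ℕ) (c : S →₀ k) :
    f ((shift S a b ^ n) c) = (shift S' a b ^ n) (f c) := by
  induction n generalizing c with
  | zero => simp
  | succ n ih =>
    rw [pow_succ, pow_succ, Module.End.mul_apply, Module.End.mul_apply, ih]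
    congr 1
    simp [shift_apply, hf]

lemma translate_mem {U : Set S} (hU : ∀ (g : G), ∀ s ∈ U, g +ᵥ s ∈ U) (g : G) {c : S →₀ k}
    (hc : c ∈ supported k k U) : translate k S g c ∈ supported k k U := by
  refine map_mem_of_mem_supported ?_ hc
  intro s hs
  rw [translate_single]
  exact single_mem_supported _ _ (hU g s hs)

lemma shift_pow_mem {U : Set S} (hU : ∀ (g : G), ∀ s ∈ U, g +ᵥ s ∈ U) (n : ℕ) {c : S →₀ k}
    (hc : c ∈ supported k k U) : (shift S a b ^ n) c ∈ supported k k U := by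
  induction n with
  | zero => simpa using hc
  | succ n ih =>
    rw [pow_succ', Module.End.mul_apply, shift_apply]
    exact Submodule.sum_mem _ fun i _ => Submodule.smul_mem _ _
      (Submodule.sub_mem _ (translate_mem hU _ ih) ih)

lemma config_vadd_mem {n : ℕ} (E : ℕ → Set G) (g : G) :
    ∀ l ∈ config n E, g +ᵥ l ∈ config n E := by
  unfold config
  generalize (n + 1) / 2 = m
  induction m with
  | zero =>
    rintro l rfl
    rfl
  | succ m ih =>
    rintro _ ⟨l, hl, l', ⟨h1, h2⟩, rfl⟩
    refine ⟨_, ih l hl, g +ᵥ l', ⟨?_, ?_⟩, (List.map_append ..).symm⟩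
    · intro x hx
      obtain ⟨y, hy, rfl⟩ := List.mem_map.1 hx
      exact h1 y hy
    · rw [list_vadd_def, List.pairwise_map]
      simpa [prod_vadd_def] using h2

end Shift

section Zigzag

/-- The exponents `0, 1, p - 1, 1, p - 1, …` of the periodic resolution of a cyclic group. -/
def zigzagExp (p : ℕ) : ℕ → ℕ
  | 0 => 0
  | m + 1 => if Even m then 1 else p - 1

lemma zigzagExp_add {p : ℕ} (hp : p.Prime) (m : ℕ) :
    zigzagExp p (m + 2) + zigzagExp p (m + 1) = p := by
  have := hp.two_le
  by_cases h : Even m <;> simp [zigzagExp, h, Nat.even_add_one] <;> omega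

variable {k G ι α β : Type*} [Field k] [AddCommGroup G] [AddAction G α] [AddAction G β] [Fintype ι]

lemma cone_translate (g : G) (x : α) (c : List α →₀ k) :
    cone (g +ᵥ x) (translate k _ g c) = translate k _ g (cone x c) := by
  have : cone (g +ᵥ x) ∘ₗ translate k (List α) g = translate k (List α) g ∘ₗ cone x := by
    ext l : 2
    simp [list_vadd_def]
  exact LinearMap.congr_fun this c

lemma bdry_translate (g : G) (c : List α →₀ k) :
    bdry (translate k _ g c) = translate k _ g (bdry c) := by
  have : bdry ∘ₗ translate k (List α) g = translate k (List α) g ∘ₗ bdry := by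
    ext l : 2
    simp only [LinearMap.comp_apply, lsingle_apply]
    induction l with
    | nil => simp [bdry_nil, list_vadd_def]
    | cons x l ih =>
      rw [← cone_single, ← cone_translate, bdry_cone, bdry_cone, ih, map_sub, cone_translate]
  exact LinearMap.congr_fun this c

lemma shift_nil (a : ι → k) (b : ι → G) (x : k) :
    shift (List α) a b (single [] x) = 0 := by
  simp [shift_apply, list_vadd_def]

theorem exists_zigzag {p : ℕ} (hp : p.Prime) (hk : (p : k) = 0) (a : ι → k) {b : ι → G}
    (hb : ∀ i, p • b i = 0) {U : Set (List α)} {n : ℕ} (hU : Contractible k U n)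
    (hinv : ∀ (g : G), ∀ l ∈ U, g +ᵥ l ∈ U) (hnil : [] ∈ U) :
    ∃ x : ℕ → (List α →₀ k), x 0 = single [] 1 ∧ (∀ m, x m ∈ supported k k (graded U m)) ∧
      ∀ m < n, bdry (x (m + 1)) = (shift (List α) a b ^ zigzagExp p m) (x m) := by
  obtain ⟨h, h1, h2⟩ := hU
  have hinv' (m : ℕ) : ∀ (g : G), ∀ l ∈ graded U m, g +ᵥ l ∈ graded U m :=
    fun g l hl => ⟨hinv g l hl.1, by rw [list_vadd_def, List.length_map, hl.2]⟩
  let x : ℕ → (List α →₀ k) := fun m => Nat.rec (single [] 1)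
    (fun m y => h ((shift (List α) a b ^ zigzagExp p m) y)) m
  have hx (m) : x m ∈ supported k k (graded U m) := by
    induction m with
    | zero => exact single_mem_supported _ _ ⟨hnil, rfl⟩
    | succ m ih => exact h1 _ _ (shift_pow_mem a b (hinv' m) _ ih)
  refine ⟨x, rfl, hx, ?_⟩
  have cyc (m : ℕ) (hm : bdry ((shift (List α) a b ^ zigzagExp p m) (x m)) = 0) (hmn : m < n) :
      bdry (x (m + 1)) = (shift (List α) a b ^ zigzagExp p m) (x m) := by
    have := h2 m hmn _ (shift_pow_mem a b (hinv' m) (zigzagExp p m) (hx m))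
    rwa [hm, map_zero, add_zero] at this
  intro m
  induction m with
  | zero => exact cyc 0 (by simp [zigzagExp, x, bdry_nil])
  | succ m ih =>
    intro hmn
    refine cyc _ ?_ hmn
    rw [map_shift_pow a b bdry_translate, ih (by omega), ← Module.End.mul_apply, ← pow_add]
    cases m with
    | zero => simp [zigzagExp, x, shift_nil]
    | succ m => rw [zigzagExp_add hp, shift_pow_prime a b hp hk hb, LinearMap.zero_apply]

end Zigzag

section Subdivision

variable {k G α β : Type*} [Field k]

/-- The subdivision operator sending a list `l` to the cone with apex `Λ l` over the subdivision
of its boundary, truncated at length `n`. -/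
noncomputable def subdiv (Λ : List α → β) : ℕ → ((List α →₀ k) →ₗ[k] (List β →₀ k))
  | 0 => linearCombination k fun l => if l.isEmpty then single [] 1 else 0
  | n + 1 => linearCombination k fun l =>
      if l.isEmpty then single [] 1 else cone (Λ l) (subdiv Λ n (bdry (single l 1)))

lemma subdiv_nil (Λ : List α → β) (n : ℕ) : subdiv Λ n (single [] (1 : k)) = single [] 1 := by
  cases n <;> simp [subdiv]

lemma subdiv_succ (Λ : List α → β) (n : ℕ) {l : List α} (hl : l ≠ []) :
    subdiv Λ (n + 1) (single l (1 : k)) = cone (Λ l) (subdiv Λ n (bdry (single l 1))) := by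
  simp [subdiv, hl]

lemma subdiv_zero (Λ : List α → β) {l : List α} (hl : l ≠ []) :
    subdiv Λ 0 (single l (1 : k)) = 0 := by
  simp [subdiv, hl]

lemma bdry_subdiv (Λ : List α → β) (n : ℕ) (c : List α →₀ k) :
    bdry (subdiv Λ (n + 1) c) = subdiv Λ n (bdry c) := by
  have key (n : ℕ) : bdry ∘ₗ subdiv Λ (n + 1) = subdiv (k := k) Λ n ∘ₗ bdry := by
    induction n with
    | zero =>
      ext l : 2
      simp only [LinearMap.comp_apply, lsingle_apply]
      by_cases hl : l = []
      · subst hl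
        rw [subdiv_nil, bdry_nil, bdry_nil, map_zero]
      · have h0 (c : List α →₀ k) : bdry (subdiv Λ 0 c) = 0 := by
          have : bdry ∘ₗ subdiv Λ 0 = (0 : (List α →₀ k) →ₗ[k] (List β →₀ k)) := by
            ext l : 2
            simp only [LinearMap.comp_apply, lsingle_apply, LinearMap.zero_apply]
            by_cases hl : l = []
            · subst hl
              rw [subdiv_nil, bdry_nil]
            · rw [subdiv_zero Λ hl, map_zero]
          exact LinearMap.congr_fun this c
        rw [subdiv_succ Λ 0 hl, bdry_cone, h0, map_zero, sub_zero]
    | succ n ih =>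
      ext l : 2
      simp only [LinearMap.comp_apply, lsingle_apply]
      by_cases hl : l = []
      · subst hl
        rw [subdiv_nil, bdry_nil, bdry_nil, map_zero]
      · have := LinearMap.congr_fun ih (bdry (single l (1 : k)))
        simp only [LinearMap.comp_apply, bdry_bdry, map_zero] at this
        rw [subdiv_succ Λ _ hl, bdry_cone, this, map_zero, sub_zero]
  exact LinearMap.congr_fun (key n) c

lemma subdiv_translate [AddCommGroup G] [AddAction G α] [AddAction G β] {Λ : List α → β}
    (hΛ : ∀ (g : G) (l : List α), Λ (g +ᵥ l) = g +ᵥ Λ l) (n : ℕ) (g : G) (c : List α →₀ k) :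
    subdiv Λ n (translate k _ g c) = translate k _ g (subdiv Λ n c) := by
  have key (n : ℕ) : subdiv Λ n ∘ₗ translate k (List α) g
      = translate k (List β) g ∘ₗ subdiv Λ n := by
    have e0 : g +ᵥ ([] : List α) = [] := rfl
    have e0' : g +ᵥ ([] : List β) = [] := rfl
    have e1 {l : List α} (hl : l ≠ []) : g +ᵥ l ≠ [] := by simpa [list_vadd_def] using hl
    induction n with
    | zero =>
      ext l : 2
      simp only [LinearMap.comp_apply, lsingle_apply, translate_single]
      by_cases hl : l = []
      · subst hl
        rw [e0, subdiv_nil, translate_single, e0']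
      · rw [subdiv_zero Λ hl, subdiv_zero Λ (e1 hl), map_zero]
    | succ n ih =>
      ext l : 2
      simp only [LinearMap.comp_apply, lsingle_apply, translate_single]
      by_cases hl : l = []
      · subst hl
        rw [e0, subdiv_nil, translate_single, e0']
      · have := LinearMap.congr_fun ih (bdry (single l (1 : k)))
        simp only [LinearMap.comp_apply] at this
        rw [subdiv_succ Λ n hl, subdiv_succ Λ n (e1 hl), hΛ, ← cone_translate, ← this,
          ← bdry_translate, translate_single]
  exact LinearMap.congr_fun (key n) c

/-- The lists occurring in the subdivision of a list: flags of faces, with `Λ` applied. -/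
inductive IsFlag (Λ : List α → β) : List α → List β → Prop
  | nil : IsFlag Λ [] []
  | cons {l l₀ : List α} {r : List β} : l₀.Sublist l → l₀.length + 1 = l.length →
      IsFlag Λ l₀ r → IsFlag Λ l (Λ l :: r)

lemma subdiv_mem (Λ : List α → β) (n : ℕ) (l : List α) :
    subdiv Λ n (single l (1 : k)) ∈ supported k k {r | IsFlag Λ l r} := by
  induction n generalizing l with
  | zero =>
    by_cases hl : l = []
    · subst hl
      rw [subdiv_nil]
      exact single_mem_supported _ _ IsFlag.nil
    · rw [subdiv_zero Λ hl]
      exact Submodule.zero_mem _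
  | succ n ih =>
    by_cases hl : l = []
    · subst hl
      rw [subdiv_nil]
      exact single_mem_supported _ _ IsFlag.nil
    · rw [subdiv_succ Λ n hl]
      refine map_mem_of_mem_supported (f := (cone (Λ l) : (List β →₀ k) →ₗ[k] _) ∘ₗ subdiv Λ n)
        (S := supported k k {r | IsFlag Λ l r}) ?_ (bdry_single_mem l)
      rintro l₀ ⟨h1, h2⟩
      rw [LinearMap.comp_apply]
      refine map_mem_of_mem_supported ?_ (ih l₀)
      intro r hr
      rw [cone_single]
      exact single_mem_supported _ _ (IsFlag.cons h1 h2 hr)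

lemma IsFlag.length_eq {Λ : List α → β} {l : List α} {r : List β} (h : IsFlag Λ l r) :
    r.length = l.length := by
  induction h with
  | nil => rfl
  | cons h1 h2 _ ih => simp [ih, h2]

/-- Transport of support conditions along the subdivision operator. -/
lemma subdiv_mem_of_flag {Λ : List α → β} {U : Set (List α)} {W : Set (List β)}
    (h : ∀ l ∈ U, ∀ r, IsFlag Λ l r → r ∈ W) (n : ℕ) {c : List α →₀ k}
    (hc : c ∈ supported k k U) : subdiv Λ n c ∈ supported k k W :=
  map_mem_of_mem_supported (fun l hl => supported_mono (h l hl) (subdiv_mem Λ n l)) hc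

end Subdivision

section Exactness

variable {k M : Type*} [Field k] [AddCommGroup M] [Module k M]

/-- A Weyl algebra relation `[s, t] = w` with `w` invertible forces `ker t ⊆ im t ^ n`. -/
lemma exists_eq_pow_apply_of_commutator {t s w J : Module.End k M} {V : Submodule k M}
    (hs : ∀ v ∈ V, s v ∈ V) (hJ : ∀ v ∈ V, J v ∈ V) (hst : s * t = t * s + w)
    (hwt : Commute w t) (hJt : Commute J t) (hJw : ∀ v ∈ V, J (w v) = v) {v : M} (hv : v ∈ V)
    (htv : t v = 0) {n : ℕ} (hn : ∀ m, 0 < m → m ≤ n → (m : k) ≠ 0) :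
    ∃ u ∈ V, v = (t ^ n) u := by
  have comm (m : ℕ) (u : M) : s ((t ^ (m + 1)) u) = (t ^ (m + 1)) (s u)
      + ((m + 1 : ℕ) : k) • w ((t ^ m) u) := by
    induction m generalizing u with
    | zero => simpa using LinearMap.congr_fun hst u
    | succ m ih =>
      have h1 := LinearMap.congr_fun hst ((t ^ (m + 1)) u)
      have h2 := LinearMap.congr_fun hwt.eq ((t ^ m) u)
      simp only [LinearMap.add_apply, Module.End.mul_apply] at h1 h2
      rw [pow_succ', Module.End.mul_apply, h1, ih, map_add, map_smul, ← h2,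
        ← Module.End.mul_apply t, ← Module.End.mul_apply t, ← pow_succ', ← pow_succ',
        Nat.cast_succ (m + 1), add_smul, one_smul, add_assoc]
  induction n with
  | zero => exact ⟨v, hv, by simp⟩
  | succ n ih =>
    obtain ⟨u, hu, rfl⟩ := ih fun m h h' => hn m h (by omega)
    have h0 := hn (n + 1) (by omega) le_rfl
    refine ⟨J (-(((n + 1 : ℕ) : k)⁻¹ • s u)), hJ _ (V.neg_mem (V.smul_mem _ (hs u hu))), ?_⟩
    have h1 := comm n u
    rw [pow_succ', Module.End.mul_apply, htv, map_zero, ← pow_succ'] at h1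
    have h2 := LinearMap.congr_fun (hJt.pow_right (n + 1)).eq (-(((n + 1 : ℕ) : k)⁻¹ • s u))
    simp only [Module.End.mul_apply] at h2
    rw [← h2, map_neg, map_smul, eq_neg_of_add_eq_zero_left h1.symm, smul_neg, neg_neg,
      smul_smul, inv_mul_cancel₀ h0, one_smul, hJw _ hv]

/-- If `ker t ⊆ im t ^ n` on `V`, then `ker t ^ i ⊆ im t ^ j` on `V` for `i + j = n + 1`. -/
lemma exists_eq_pow_apply_of_pow_apply_eq_zero {t : Module.End k M} {V : Submodule k M} {n : ℕ}
    (ht : ∀ v ∈ V, t v ∈ V) (h : ∀ v ∈ V, t v = 0 → ∃ u ∈ V, v = (t ^ n) u) {i j : ℕ}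
    (hij : i + j = n + 1) {v : M} (hv : v ∈ V) (hv0 : (t ^ i) v = 0) :
    ∃ u ∈ V, v = (t ^ j) u := by
  have htpow (m : ℕ) : ∀ v ∈ V, (t ^ m) v ∈ V := by
    induction m with
    | zero => simp
    | succ m ih =>
      intro v hv
      rw [pow_succ', Module.End.mul_apply]
      exact ht _ (ih v hv)
  induction i generalizing j v with
  | zero => exact ⟨0, V.zero_mem, by simpa using hv0⟩
  | succ i ih =>
    rw [pow_succ', Module.End.mul_apply] at hv0
    obtain ⟨u, hu, hu'⟩ := h _ (htpow i v hv) hv0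
    obtain ⟨u', hu1, hu2⟩ := ih (j := j + 1) (v := v - (t ^ j) u) (by omega)
      (V.sub_mem hv (htpow j u hu)) (by
        rw [map_sub, hu', ← Module.End.mul_apply, ← pow_add, show i + j = n by omega, sub_self])
    refine ⟨u + t u', V.add_mem hu (ht _ hu1), ?_⟩
    rw [map_add, ← Module.End.mul_apply, ← pow_succ, ← hu2]
    abel

end Exactness

section Functionals

/-- A cocycle on a `G`-set for an elementary abelian group `G`, nontrivial away from the fixed
points. -/
lemma exists_orbit_functional (p : ℕ) [Fact p.Prime] (G S : Type*) [AddCommGroup G]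
    [Module (ZMod p) G] [AddAction G S] :
    ∃ (c : S → (G →ₗ[ZMod p] ZMod p)) (s : S → ZMod p),
      (∀ (g : G) σ, c (g +ᵥ σ) = c σ) ∧ (∀ (g : G) σ, s (g +ᵥ σ) = s σ + c σ g) ∧
      ∀ σ, c σ = 0 → ∀ g : G, g +ᵥ σ = σ := by
  have hfun (ρ : S) : ∃ c : G →ₗ[ZMod p] ZMod p, (∀ g : G, g +ᵥ ρ = ρ → c g = 0) ∧
      (c = 0 → ∀ g : G, g +ᵥ ρ = ρ) := by
    let W : Submodule (ZMod p) G := AddSubgroup.toZModSubmodule p (AddAction.stabilizer G ρ)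
    have hW (g : G) : g ∈ W ↔ g +ᵥ ρ = ρ := by
      simp [W, AddAction.mem_stabilizer_iff]
    by_cases h : W = ⊤
    · exact ⟨0, by simp, fun _ g => (hW g).1 (h ▸ Submodule.mem_top)⟩
    · obtain ⟨c, hc0, hc⟩ := Submodule.exists_le_ker_of_lt_top W (lt_top_iff_ne_top.2 h)
      exact ⟨c, fun g hg => hc ((hW g).2 hg), fun h => absurd h hc0⟩
  choose c₀ h1 h2 using hfun
  let rep (σ : S) : S := (Quotient.mk (AddAction.orbitRel G S) σ).out
  have hrep (g : G) (σ : S) : rep (g +ᵥ σ) = rep σ := by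
    have : (Quotient.mk (AddAction.orbitRel G S) (g +ᵥ σ)) = Quotient.mk _ σ :=
      Quotient.sound ⟨g, rfl⟩
    simp only [rep, this]
  have horb (σ : S) : ∃ g : G, g +ᵥ rep σ = σ := by
    have : AddAction.orbitRel G S σ (rep σ) :=
      (AddAction.orbitRel G S).symm (Quotient.mk_out (s := AddAction.orbitRel G S) σ)
    exact this
  choose γ hγ using horb
  refine ⟨fun σ => c₀ (rep σ), fun σ => c₀ (rep σ) (γ σ), ?_, ?_, ?_⟩
  · intro g σ
    simp only [hrep]
  · intro g σ
    simp only [hrep]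
    rw [← sub_eq_zero, ← map_add, ← map_sub]
    refine h1 _ _ ?_
    have e1 := hγ (g +ᵥ σ)
    rw [hrep] at e1
    have e2 : (γ σ + g) +ᵥ rep σ = g +ᵥ σ := by rw [add_comm, add_vadd, hγ]
    rw [sub_eq_neg_add, add_vadd, e1, neg_vadd_eq_iff, e2]
  · intro σ h g
    rw [← hγ σ, h2 _ h, h2 _ h]

end Functionals

section Free

variable {k G ι S : Type*} [Field k] [AddCommGroup G] [AddAction G S] [Fintype ι]

/-- The diagonal operator with eigenvalues `f`. -/
noncomputable def scale (f : S → k) : Module.End k (S →₀ k) :=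
  linearCombination k fun σ => single σ (f σ)

@[simp] lemma scale_single (f : S → k) (σ : S) (x : k) :
    scale f (single σ x) = single σ (x * f σ) := by
  simp [scale]

lemma scale_mem (f : S → k) {U : Set S} {c : S →₀ k} (hc : c ∈ supported k k U) :
    scale f c ∈ supported k k U := by
  refine map_mem_of_mem_supported ?_ hc
  intro σ hσ
  rw [scale_single]
  exact single_mem_supported _ _ hσ

lemma scale_commute_translate {f : S → k} {g : G} (hf : ∀ σ, f (g +ᵥ σ) = f σ) :
    Commute (scale f) (translate k S g) := by
  rw [commute_iff_eq]
  ext σ : 2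
  simp [hf]

lemma scale_pow (f : S → k) (n : ℕ) : scale f ^ n = scale (f ^ n) := by
  induction n with
  | zero =>
    ext σ : 2
    simp
  | succ n ih =>
    rw [pow_succ, ih]
    ext σ : 2
    simp [pow_succ, mul_comm]

lemma scale_commute (f g : S → k) : Commute (scale f) (scale g) := by
  rw [commute_iff_eq]
  ext σ : 2
  simp [mul_comm]

lemma commute_shift {A : Module.End k (S →₀ k)} (a : ι → k) (b : ι → G)
    (hA : ∀ g : G, Commute A (translate k S g)) : Commute A (shift S a b) := by
  refine Commute.sum_right _ _ _ fun i _ => ?_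
  have h : Commute A (translate k S (b i) - 1) :=
    Commute.sub_right (R := Module.End k (S →₀ k)) (hA (b i)) (Commute.one_right A)
  exact h.smul_right _

theorem shift_exact {p : ℕ} [Fact p.Prime] [Module (ZMod p) G] [Algebra (ZMod p) k] {a : ι → k}
    {b : ι → G} (ha : LinearIndependent (ZMod p) a) (hb : Submodule.span (ZMod p) (Set.range b) = ⊤)
    {U : Set S} (hU : ∀ (g : G), ∀ σ ∈ U, g +ᵥ σ ∈ U) (hfix : ∀ σ ∈ U, ∃ g : G, g +ᵥ σ ≠ σ)
    {i j : ℕ} (hij : i + j = p) {v : S →₀ k} (hv : v ∈ supported k k U)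
    (hv0 : (shift S a b ^ i) v = 0) : ∃ u ∈ supported k k U, v = (shift S a b ^ j) u := by
  have hp : p.Prime := Fact.out
  have : CharP k p := (Algebra.charP_iff (ZMod p) k p).1 (ZMod.charP p)
  have hR := natCast_end_eq_zero (CharP.cast_eq_zero k p) (S →₀ k)
  obtain ⟨c, s₀, hc, hs₀, hcfix⟩ := exists_orbit_functional p G S
  let co (i : ι) (σ : S) : k := a i * algebraMap (ZMod p) k (c σ (b i))
  let γ (σ : S) : k := ∑ i, co i σ
  let x (i : ι) : Module.End k (S →₀ k) := translate k S (b i) * scale (co i)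
  let w : Module.End k (S →₀ k) := ∑ i, x i
  let s : Module.End k (S →₀ k) := scale fun σ => algebraMap (ZMod p) k (s₀ σ)
  let J : Module.End k (S →₀ k) := scale (γ ^ p)⁻¹ * w ^ (p - 1)
  have hco (i : ι) (g : G) (σ : S) : co i (g +ᵥ σ) = co i σ := by simp only [co, hc]
  have hxt (i : ι) (g : G) : Commute (x i) (translate k S g) :=
    (translate_commute _ _).mul_left (scale_commute_translate (hco i g))
  have hxx (i j : ι) : Commute (x i) (x j) :=
    (hxt i _).mul_right
      (((scale_commute_translate (hco j (b i))).mul_right (scale_commute _ _)).symm)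
  have hwt (g : G) : Commute w (translate k S g) := Commute.sum_left _ _ _ fun i _ => hxt i g
  have hJt (g : G) : Commute J (translate k S g) :=
    (scale_commute_translate fun σ => by simp [γ, hco]).mul_left ((hwt g).pow_left _)
  have hwmem : ∀ v ∈ supported k k U, w v ∈ supported k k U := fun v hv => by
    simp only [w, LinearMap.sum_apply]
    exact Submodule.sum_mem _ fun i _ => translate_mem hU _ (scale_mem _ hv)
  have hwpow (n : ℕ) : ∀ v ∈ supported k k U, (w ^ n) v ∈ supported k k U := by
    induction n with
    | zero => simp
    | succ n ih =>
      intro v hv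
      rw [pow_succ', Module.End.mul_apply]
      exact hwmem _ (ih v hv)
  have hγ (σ : S) (hσ : σ ∈ U) : γ σ ≠ 0 := by
    intro h0
    obtain ⟨g, hg⟩ := hfix σ hσ
    refine hg (hcfix σ ?_ g)
    refine LinearMap.ext_on_range hb fun i => ?_
    refine Fintype.linearIndependent_iff.1 ha (fun i => c σ (b i)) ?_ i
    rw [← h0]
    exact Finset.sum_congr rfl fun i _ => by rw [Algebra.smul_def, mul_comm]
  have hw : w ^ p = scale (γ ^ p) := by
    rw [sum_pow_prime hp hR hxx]
    ext σ : 2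
    have hxp (i : ι) : x i ^ p = scale (co i ^ p) := by
      rw [((scale_commute_translate (hco i (b i))).symm).mul_pow, translate_pow, scale_pow,
        ← Nat.cast_smul_eq_nsmul (ZMod p), CharP.cast_eq_zero, zero_smul, translate_zero, one_mul]
    simp [hxp, γ, sum_pow_char, ← Finsupp.single_finsetSum]
  have hst : s * shift S a b = shift S a b * s + w := by
    ext σ : 2
    simp only [LinearMap.comp_apply, Module.End.mul_apply, LinearMap.add_apply, lsingle_apply,
      shift_apply, map_sum, s, scale_single, w, LinearMap.sum_apply, ← Finset.sum_add_distrib, x,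
      translate_single, map_sub, map_smul, hs₀, map_add]
    refine Finset.sum_congr rfl fun i _ => ?_
    simp only [co, smul_sub, smul_add, smul_single, smul_eq_mul, one_mul, mul_add, single_add]
    abel
  refine exists_eq_pow_apply_of_pow_apply_eq_zero (n := p - 1)
    (fun v hv => by simpa using shift_pow_mem a b hU 1 hv) (fun v hv hv0 => ?_)
    (by have := hp.one_lt; omega) hv hv0
  refine exists_eq_pow_apply_of_commutator (s := s) (w := w) (J := J) (fun v hv => scale_mem _ hv)
    (fun v hv => scale_mem _ (hwpow _ v hv)) hst (commute_shift a b hwt) (commute_shift a b hJt)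
    (fun v hv => ?_) hv hv0 fun m hm hmp => ?_
  · rw [← Module.End.mul_apply, mul_assoc, ← pow_succ, Nat.sub_add_cancel hp.one_le, hw]
    refine eq_of_mem_supported (f := scale (γ ^ p)⁻¹ * scale (γ ^ p)) (g := LinearMap.id)
      (fun σ hσ => ?_) hv
    simp [mul_inv_cancel₀ (pow_ne_zero p (hγ σ hσ))]
  · rw [Ne, CharP.cast_eq_zero_iff k p]
    exact fun h => by have := Nat.le_of_dvd hm h; have := hp.one_lt; omega

end Free

section Descent

variable {k M : Type*} [Field k] [AddCommGroup M] [Module k M]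

/-- A zigzag in a complex of modules on which `t` acts freely cannot terminate. -/
lemma zigzag_eq_zero {p : ℕ} (hp : p.Prime) {D t : Module.End k M} (hDD : ∀ v, D (D v) = 0)
    (hDt : ∀ (n : ℕ) v, D ((t ^ n) v) = (t ^ n) (D v)) {V : ℕ → Submodule k M}
    (hD : ∀ n, ∀ v ∈ V (n + 1), D v ∈ V n)
    (hex : ∀ n, ∀ i j, i + j = p → ∀ v ∈ V (n + 1), (t ^ i) v = 0 → ∃ u ∈ V (n + 1), v = (t ^ j) u)
    (h0 : ∀ v ∈ V 0, t v = 0) {y : ℕ → M} (hy : ∀ n, y n ∈ V n) {N : ℕ}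
    (hbd : ∀ m ≤ N, D (y (m + 1)) = (t ^ zigzagExp p m) (y m)) (hN : y (N + 1) = 0) :
    y 0 = 0 := by
  have key (m : ℕ) (hm : m ≤ N) : ∃ z ∈ V (N - m + 2), ∃ z' ∈ V (N - m + 1),
      y (N - m + 1) = D z + (t ^ zigzagExp p (N - m + 2)) z' := by
    induction m with
    | zero => exact ⟨0, Submodule.zero_mem _, 0, Submodule.zero_mem _, by simp [hN]⟩
    | succ m ih =>
      obtain ⟨n, hn⟩ : ∃ n, N - m = n + 1 := ⟨N - (m + 1), by omega⟩
      rw [show N - (m + 1) = n by omega]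
      rw [hn] at ih
      obtain ⟨z, hz, z', hz', e⟩ := ih (by omega)
      have h1 := hbd (n + 1) (by omega)
      have hexp : zigzagExp p (n + 1 + 2) = zigzagExp p (n + 1) := by
        have h1 := zigzagExp_add hp n
        have h2 := zigzagExp_add hp (n + 1)
        rw [show n + 1 + 1 = n + 2 by rfl] at h2
        omega
      rw [e, map_add, hDD, zero_add, hDt, hexp] at h1
      obtain ⟨u, hu, hu'⟩ := hex n (zigzagExp p (n + 1)) (zigzagExp p (n + 2))
        (by rw [add_comm, zigzagExp_add hp]) (y (n + 1) - D z')
        (Submodule.sub_mem _ (hy _) (hD _ _ hz')) (by rw [map_sub, h1, sub_self])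
      exact ⟨z', hz', u, hu, by rw [← hu']; abel⟩
  obtain ⟨z, -, z', hz', e⟩ := key N le_rfl
  simp only [Nat.sub_self, zero_add] at e hz'
  have h1 := hbd 0 (by omega)
  obtain ⟨n, hn⟩ : ∃ n, zigzagExp p 2 = n + 1 := by
    have := hp.two_le
    exact ⟨p - 2, by simp [zigzagExp]; omega⟩
  rw [zero_add, e, map_add, hDD, zero_add, hDt, hn, pow_succ, Module.End.mul_apply,
    h0 _ (hD 0 _ hz'), map_zero] at h1
  simpa [zigzagExp] using h1.symm

end Descent

section Normalize

variable {k β : Type*} [Field k] [PartialOrder β]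

open Classical in
/-- The projection of ordered chains that kills lists which are not strictly decreasing. -/
noncomputable def strictPart : (List β →₀ k) →ₗ[k] (List β →₀ k) :=
  linearCombination k fun l => if l.Pairwise (· > ·) then single l 1 else 0

lemma strictPart_of_strict {l : List β} (hl : l.Pairwise (· > ·)) :
    strictPart (single l (1 : k)) = single l 1 := by
  simp [strictPart, hl]

lemma strictPart_of_not_strict {l : List β} (hl : ¬ l.Pairwise (· > ·)) :
    strictPart (single l (1 : k)) = 0 := by
  simp [strictPart, hl]

lemma strictPart_cone (a : β) (c : List β →₀ k) :
    strictPart (cone a (strictPart c)) = strictPart (cone a c) := by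
  have : strictPart ∘ₗ cone a ∘ₗ strictPart
      = strictPart ∘ₗ (cone a : (List β →₀ k) →ₗ[k] _) := by
    ext l : 2
    simp only [LinearMap.comp_apply, lsingle_apply]
    by_cases hl : l.Pairwise (· > ·)
    · rw [strictPart_of_strict hl]
    · rw [strictPart_of_not_strict hl, map_zero, map_zero, cone_single, strictPart_of_not_strict]
      exact fun h => hl (List.pairwise_cons.1 h).2
  exact LinearMap.congr_fun this c

lemma strictPart_cone_cone (a : β) (c : List β →₀ k) : strictPart (cone a (cone a c)) = 0 := by
  have : strictPart ∘ₗ cone a ∘ₗ cone a = (0 : (List β →₀ k) →ₗ[k] (List β →₀ k)) := by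
    ext l : 2
    simp only [LinearMap.comp_apply, lsingle_apply, LinearMap.zero_apply, cone_single]
    exact strictPart_of_not_strict (by simp)
  exact LinearMap.congr_fun this c

lemma strictPart_bdry_eq_zero {l : List β} (hl : l.Pairwise (· ≥ ·)) (hl' : ¬ l.Pairwise (· > ·)) :
    strictPart (bdry (single l (1 : k))) = 0 := by
  induction l with
  | nil => simp at hl'
  | cons a l ih =>
    rw [List.pairwise_cons] at hl
    by_cases hs : l.Pairwise (· > ·)
    · cases l with
      | nil => simp at hl'
      | cons b l =>
        have hab : b = a := by
          by_contra hne
          have hba : b < a := lt_of_le_of_ne (hl.1 b (by simp)) hne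
          refine hl' (List.pairwise_cons.2 ⟨fun c hc => ?_, hs⟩)
          rcases List.mem_cons.1 hc with rfl | hc
          · exact hba
          · exact ((List.pairwise_cons.1 hs).1 c hc).trans hba
        subst hab
        rw [bdry_cons, bdry_cons, map_sub (cone (k := k) b), cone_single, sub_sub_cancel,
          strictPart_cone_cone]
    · rw [bdry_cons, map_sub, strictPart_of_not_strict hs, ← strictPart_cone, ih hl.2 hs, map_zero,
        map_zero, sub_zero]

lemma bdry_strictPart {c : List β →₀ k} (hc : c ∈ supported k k {l : List β | l.Pairwise (· ≥ ·)}) :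
    bdry (strictPart c) = strictPart (bdry c) := by
  refine eq_of_mem_supported (f := bdry ∘ₗ strictPart) (g := strictPart ∘ₗ bdry) (fun l hl => ?_) hc
  simp only [LinearMap.comp_apply]
  by_cases hs : l.Pairwise (· > ·)
  · rw [strictPart_of_strict hs]
    symm
    refine eq_of_mem_supported (k := k) (f := strictPart) (g := LinearMap.id) (fun l' hl' => ?_)
      (bdry_single_mem l)
    exact strictPart_of_strict (hs.sublist hl'.1)
  · rw [strictPart_of_not_strict hs, map_zero, strictPart_bdry_eq_zero hl hs]

lemma strictPart_translate {G : Type*} [AddCommGroup G] [AddAction G β]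
    (hlt : ∀ (g : G) (x y : β), g +ᵥ x < g +ᵥ y ↔ x < y) (g : G) (c : List β →₀ k) :
    strictPart (translate k _ g c) = translate k _ g (strictPart c) := by
  have : strictPart ∘ₗ translate k (List β) g = translate k (List β) g ∘ₗ strictPart := by
    ext l : 2
    simp only [LinearMap.comp_apply, lsingle_apply, translate_single]
    have e : (g +ᵥ l).Pairwise (· > ·) ↔ l.Pairwise (· > ·) := by
      rw [list_vadd_def, List.pairwise_map]
      simp only [gt_iff_lt, hlt]
    by_cases hs : l.Pairwise (· > ·)
    · rw [strictPart_of_strict hs, strictPart_of_strict (e.2 hs), translate_single]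
    · rw [strictPart_of_not_strict hs, strictPart_of_not_strict fun h => hs (e.1 h), map_zero]
  exact LinearMap.congr_fun this c

lemma length_le_of_pairwise_gt {ρ : β → ℕ} (hρ : StrictMono ρ) {l : List β}
    (hl : l.Pairwise (· > ·)) {N : ℕ} (h : ∀ x ∈ l, ρ x ≠ 0 ∧ ρ x ≤ N) : l.length ≤ N := by
  have hl' : (l.map ρ).Nodup := by
    rw [List.Nodup, List.pairwise_map]
    exact hl.imp fun h => (hρ h).ne'
  have := List.toFinset_card_of_nodup hl'
  rw [List.length_map] at this
  rw [← this, ← Nat.card_Icc 1 N |>.trans (Nat.add_sub_cancel ..)]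
  refine Finset.card_le_card fun n hn => ?_
  obtain ⟨x, hx, rfl⟩ := List.mem_map.1 (List.mem_toFinset.1 hn)
  have := h x hx
  exact Finset.mem_Icc.2 ⟨by omega, by omega⟩

end Normalize

/-- There is no zigzag of length `N + 1` of chains in a poset of height at most `N` without fixed
points. -/
theorem no_zigzag {k G ι β : Type*} [Field k] [AddCommGroup G] [Fintype ι] [PartialOrder β]
    [AddAction G β] {p : ℕ} [Fact p.Prime] [Module (ZMod p) G] [Algebra (ZMod p) k] {a : ι → k}
    {b : ι → G} (ha : LinearIndependent (ZMod p) a) (hb : Submodule.span (ZMod p) (Set.range b) = ⊤)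
    (hlt : ∀ (g : G) (x y : β), g +ᵥ x < g +ᵥ y ↔ x < y) {B : Set β}
    (hB : ∀ (g : G), ∀ x ∈ B, g +ᵥ x ∈ B) (hfix : ∀ x ∈ B, ∃ g : G, g +ᵥ x ≠ x) {N : ℕ} {ρ : β → ℕ}
    (hρ : StrictMono ρ) (hρB : ∀ x ∈ B, ρ x ≠ 0 ∧ ρ x ≤ N) {x : ℕ → (List β →₀ k)}
    (hx0 : x 0 = single [] 1)
    (hx : ∀ m, x m ∈ supported k k
      {l : List β | (l.Pairwise (· ≥ ·) ∧ ∀ y ∈ l, y ∈ B) ∧ l.length = m})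
    (hbd : ∀ m ≤ N, bdry (x (m + 1)) = (shift (List β) a b ^ zigzagExp p m) (x m)) : False := by
  have hp : p.Prime := Fact.out
  let W (n : ℕ) : Set (List β) := {l | (l.Pairwise (· > ·) ∧ ∀ y ∈ l, y ∈ B) ∧ l.length = n}
  have hWinv (n : ℕ) (g : G) : ∀ l ∈ W n, g +ᵥ l ∈ W n := by
    rintro l ⟨⟨h1, h2⟩, h3⟩
    refine ⟨⟨?_, ?_⟩, by rw [list_vadd_def, List.length_map, h3]⟩
    · rw [list_vadd_def, List.pairwise_map]
      simpa only [gt_iff_lt, hlt] using h1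
    · intro y hy
      obtain ⟨z, hz, rfl⟩ := List.mem_map.1 hy
      exact hB g z (h2 z hz)
  have hy (n : ℕ) : strictPart (x n) ∈ supported k k (W n) := by
    refine map_mem_of_mem_supported (fun l hl => ?_) (hx n)
    by_cases hs : l.Pairwise (· > ·)
    · rw [strictPart_of_strict hs]
      exact single_mem_supported _ _ ⟨⟨hs, hl.1.2⟩, hl.2⟩
    · rw [strictPart_of_not_strict hs]
      exact Submodule.zero_mem _
  have key := zigzag_eq_zero (N := N) hp (D := bdry) (t := shift (List β) a b)
    (V := fun n => supported k k (W n)) (y := fun n => strictPart (x n)) bdry_bdry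
    (fun n v => map_shift_pow a b bdry_translate n v) (fun n v hv => ?_)
    (fun n i j hij v hv hv0 => shift_exact ha hb (hWinv (n + 1)) ?_ hij hv hv0) (fun v hv => ?_) hy
    (fun m hm => ?_) ?_
  · rw [hx0, strictPart_of_strict (by simp)] at key
    simp at key
  · refine map_mem_of_mem_supported (fun l hl => ?_) hv
    refine supported_mono ?_ (bdry_single_mem l)
    rintro l' ⟨h1, h2⟩
    exact ⟨⟨hl.1.1.sublist h1, fun y hy => hl.1.2 y (h1.subset hy)⟩, by have := hl.2; omega⟩
  · rintro l ⟨⟨-, h2⟩, h3⟩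
    cases l with
    | nil => simp at h3
    | cons y l =>
      obtain ⟨g, hg⟩ := hfix y (h2 y (by simp))
      exact ⟨g, fun h => hg (List.cons.inj h).1⟩
  · refine eq_of_mem_supported (g := 0) (fun l hl => ?_) hv
    rw [List.length_eq_zero_iff.1 hl.2, shift_nil, LinearMap.zero_apply]
  · rw [bdry_strictPart (supported_mono (fun l hl => hl.1.1) (hx (m + 1))), hbd m hm,
      map_shift_pow a b (strictPart_translate hlt)]
  · have h0 : W (N + 1) = ∅ := by
      refine Set.eq_empty_of_forall_notMem ?_
      rintro l ⟨⟨h1, h2⟩, h3⟩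
      have := length_le_of_pairwise_gt hρ h1 fun x hx => hρB x (h2 x hx)
      omega
    have := hy (N + 1)
    rwa [h0, supported_empty, Submodule.mem_bot] at this

section ZigzagTransport

variable {k G ι α β : Type*} [Field k] [AddCommGroup G] [AddAction G α] [AddAction G β] [Fintype ι]

/-- `U` carries a zigzag of chains starting at the empty list, up to lists of length `N + 1`. -/
def HasZigzag (p : ℕ) (a : ι → k) (b : ι → G) (N : ℕ) (U : Set (List α)) : Prop :=
  ∃ x : ℕ → (List α →₀ k), x 0 = single [] 1 ∧ (∀ m, x m ∈ supported k k (graded U m)) ∧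
    ∀ m ≤ N, bdry (x (m + 1)) = (shift (List α) a b ^ zigzagExp p m) (x m)

lemma HasZigzag.subdiv {p : ℕ} {a : ι → k} {b : ι → G} {N : ℕ} {U : Set (List α)}
    {W : Set (List β)} (hU : HasZigzag p a b N U) {Λ : List α → β}
    (hΛ : ∀ (g : G) (l : List α), Λ (g +ᵥ l) = g +ᵥ Λ l)
    (hW : ∀ l ∈ U, ∀ r, IsFlag Λ l r → r ∈ W) : HasZigzag p a b N W := by
  obtain ⟨x, h0, h1, h2⟩ := hU
  refine ⟨fun m => Tverberg.subdiv Λ m (x m), ?_, fun m => ?_, fun m hm => ?_⟩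
  · simp only [h0, subdiv_nil]
  · refine subdiv_mem_of_flag (W := graded W m) (fun l hl r hr => ⟨hW l hl.1 r hr, ?_⟩) m (h1 m)
    rw [hr.length_eq, hl.2]
  · rw [bdry_subdiv, h2 m hm, map_shift_pow a b (subdiv_translate hΛ m)]

lemma hasZigzag_config {p : ℕ} (hp : p.Prime) (hk : (p : k) = 0) (a : ι → k) {b : ι → G}
    (hb : ∀ i, p • b i = 0) {N : ℕ} {E : ℕ → Set G} (hne : ∀ j, (E j).Nonempty)
    (hE : ∀ j, ∀ H : AddSubgroup G, (∀ e ∈ E j, ∀ e' ∈ E j, e - e' ∈ H) → H = ⊤) :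
    HasZigzag p a b N {l : List (Fin (N + 1) × G) | l ∈ config (N + 1) E ∧ l.length ≤ N + 1} := by
  obtain ⟨x, h0, h1, h2⟩ := exists_zigzag hp hk a hb (contractible_config hne hE)
    (config_vadd_mem (n := N + 1) E) (config_nil_mem E)
  refine ⟨fun m => if m ≤ N + 1 then x m else 0, by simp [h0], fun m => ?_, fun m hm => ?_⟩
  · beta_reduce
    split_ifs with h
    · refine supported_mono ?_ (h1 m)
      exact fun l hl => ⟨⟨hl.1, hl.2.trans_le h⟩, hl.2⟩
    · exact Submodule.zero_mem _
  · beta_reduce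
    rw [if_pos (by omega), if_pos (by omega), h2 m (by omega)]

end ZigzagTransport

section Points

variable {G : Type*} [AddCommGroup G]

/-- The regular representation in the second variable. -/
instance pointAddAction {ι : Type*} : AddAction G (ι → G → ℝ) where
  vadd g z := fun v h => z v (h - g)
  zero_vadd z := by
    change (fun v h => z v (h - 0)) = z
    simp
  add_vadd g h z := by
    change (fun v x => z v (x - (g + h))) = fun v x => z v (x - g - h)
    simp [sub_sub]

lemma point_vadd_apply {ι : Type*} (g : G) (z : ι → G → ℝ) (v : ι) (h : G) :
    (g +ᵥ z) v h = z v (h - g) := rfl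

/-- The barycenter of a list of points. -/
noncomputable def bary {V : Type*} [AddCommGroup V] [Module ℝ V] (l : List V) : V :=
  (l.length : ℝ)⁻¹ • l.sum

lemma bary_vadd {ι : Type*} (g : G) (l : List (ι → G → ℝ)) : bary (g +ᵥ l) = g +ᵥ bary l := by
  have h : (g +ᵥ l).sum = g +ᵥ l.sum := by
    rw [list_vadd_def]
    induction l with
    | nil => rfl
    | cons z l ih =>
      rw [List.map_cons, List.sum_cons, ih, List.sum_cons]
      rfl
  rw [bary, h, list_vadd_def, List.length_map]
  rfl

variable {V : Type*} [NormedAddCommGroup V] [NormedSpace ℝ V]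

lemma bary_mem {C : Set V} (hC : Convex ℝ C) {l : List V} (hl : l ≠ []) (h : ∀ z ∈ l, z ∈ C) :
    bary l ∈ C := by
  have hn : (0 : ℝ) < l.length := by exact_mod_cast List.length_pos_iff.2 hl
  have e : bary l = ∑ i : Fin l.length, (l.length : ℝ)⁻¹ • l.get i := by
    rw [← Finset.smul_sum, bary]
    congr 1
    simp [← List.sum_ofFn]
  rw [e]
  refine hC.sum_mem (fun _ _ => by positivity) ?_ fun i _ => h _ (List.get_mem l i)
  simp [hn.ne']

lemma norm_sum_sub_le {δ : ℝ} {y : V} {l : List V} (h : ∀ z ∈ l, dist z y ≤ δ) :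
    ‖l.sum - (l.length : ℝ) • y‖ ≤ l.length * δ := by
  induction l with
  | nil => simp
  | cons z l ih =>
    have h1 := ih fun x hx => h x (by simp [hx])
    have h2 := h z (by simp)
    rw [dist_eq_norm] at h2
    have e : (z :: l).sum - ((z :: l).length : ℝ) • y = (z - y) + (l.sum - (l.length : ℝ) • y) := by
      rw [List.sum_cons, List.length_cons, Nat.cast_succ, add_smul, one_smul]
      abel
    rw [e, List.length_cons, Nat.cast_succ]
    linarith [norm_add_le (z - y) (l.sum - (l.length : ℝ) • y)]

lemma dist_bary_le {δ : ℝ} {l : List V} {n : ℕ} (hn : l.length ≤ n)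
    (hδ : ∀ z ∈ l, ∀ z' ∈ l, dist z z' ≤ δ) {y : V} (hy : y ∈ l) :
    dist y (bary l) ≤ (1 - 1 / (n : ℝ)) * δ := by
  classical
  have hδ0 : 0 ≤ δ := dist_nonneg.trans (hδ y hy y hy)
  have hlen : (0 : ℝ) < l.length := by exact_mod_cast List.length_pos_of_mem hy
  have hln : (l.length : ℝ) ≤ n := by exact_mod_cast hn
  have h1 := norm_sum_sub_le (l := l.erase y) (y := y) (δ := δ)
    fun z hz => hδ z (List.mem_of_mem_erase hz) y hy
  have hsum : l.sum = y + (l.erase y).sum := by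
    rw [(List.perm_cons_erase hy).sum_eq, List.sum_cons]
  have hl1 : ((l.erase y).length : ℝ) = l.length - 1 := by
    rw [List.length_erase_of_mem hy, Nat.cast_sub (List.length_pos_of_mem hy)]
    simp
  have e : bary l - y = (l.length : ℝ)⁻¹ • ((l.erase y).sum - ((l.erase y).length : ℝ) • y) := by
    have hy' := inv_smul_smul₀ hlen.ne' y
    rw [bary, hsum, hl1, sub_smul, one_smul, smul_add, smul_sub, smul_sub, hy']
    abel
  rw [dist_comm, dist_eq_norm, e, norm_smul, norm_inv, Real.norm_natCast]
  calc (l.length : ℝ)⁻¹ * ‖(l.erase y).sum - ((l.erase y).length : ℝ) • y‖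
      ≤ (l.length : ℝ)⁻¹ * (((l.length : ℝ) - 1) * δ) := by
        rw [← hl1]
        gcongr
    _ = (1 - 1 / (l.length : ℝ)) * δ := by field_simp
    _ ≤ (1 - 1 / (n : ℝ)) * δ := by gcongr

lemma IsFlag.mem_convex {C : Set V} (hC : Convex ℝ C) {l r : List V} (h : IsFlag bary l r)
    (hl : ∀ z ∈ l, z ∈ C) : ∀ z ∈ r, z ∈ C := by
  induction h with
  | nil => simp
  | cons h1 h2 _ ih =>
    intro z hz
    rcases List.mem_cons.1 hz with rfl | hz
    · exact bary_mem hC (by rintro rfl; simp at h2) hl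
    · exact ih (fun z hz => hl z (h1.subset hz)) z hz

lemma IsFlag.dist_le {δ : ℝ} (hδ : 0 ≤ δ) {n : ℕ} {l r : List V} (h : IsFlag bary l r)
    (hn : l.length ≤ n) (hl : ∀ z ∈ l, ∀ z' ∈ l, dist z z' ≤ δ) :
    ∀ z ∈ r, ∀ z' ∈ r, dist z z' ≤ (1 - 1 / (n : ℝ)) * δ := by
  induction h with
  | nil => simp
  | @cons l l₀ r h1 h2 h3 ih =>
    have h0 : 0 ≤ (1 - 1 / (n : ℝ)) * δ := by
      refine mul_nonneg ?_ hδ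
      have : (1 : ℝ) ≤ n := by exact_mod_cast (by omega : 1 ≤ n)
      rw [sub_nonneg, div_le_one (by positivity)]
      exact this
    have hr := h3.mem_convex (convex_closedBall (bary l) ((1 - 1 / (n : ℝ)) * δ)) fun z hz =>
      dist_bary_le hn hl (h1.subset hz)
    have ih' := ih (by omega) fun z hz z' hz' => hl z (h1.subset hz) z' (h1.subset hz')
    intro z hz z' hz'
    rcases List.mem_cons.1 hz with rfl | hz <;> rcases List.mem_cons.1 hz' with rfl | hz'
    · rwa [dist_self]
    · rw [dist_comm]
      exact hr z' hz'
    · exact hr z hz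
    · exact ih' z hz z' hz'

end Points

open scoped Pointwise

section Cells

variable {G : Type*} [Fintype G] {n : ℕ}

/-- The geometric simplex with vertices `(v, φ v)`. -/
def cell (φ : Fin n → G) : Set (Fin n → G → ℝ) :=
  {z | (∀ v x, 0 ≤ z v x) ∧ ∑ v, ∑ x, z v x = 1 ∧ ∀ v x, x ≠ φ v → z v x = 0}

lemma convex_cell (φ : Fin n → G) : Convex ℝ (cell φ) := by
  rintro z ⟨h1, h2, h3⟩ z' ⟨h1', h2', h3'⟩ s t hs ht hst
  refine ⟨fun v x => ?_, ?_, fun v x hx => ?_⟩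
  · have := h1 v x
    have := h1' v x
    simp only [Pi.add_apply, Pi.smul_apply, smul_eq_mul]
    positivity
  · simp only [Pi.add_apply, Pi.smul_apply, smul_eq_mul, Finset.sum_add_distrib, ← Finset.mul_sum,
      h2, h2', mul_one, hst]
  · simp [h3 v x hx, h3' v x hx]

lemma apply_le_one_of_mem_cell {φ : Fin n → G} {z : Fin n → G → ℝ} (hz : z ∈ cell φ) (v : Fin n)
    (x : G) : z v x ≤ 1 := by
  rw [← hz.2.1]
  exact (Finset.single_le_sum (f := fun x => z v x) (fun y _ => hz.1 v y)
    (Finset.mem_univ x)).trans (Finset.single_le_sum (f := fun v => ∑ x, z v x)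
    (fun w _ => Finset.sum_nonneg fun y _ => hz.1 w y) (Finset.mem_univ v))

lemma dist_le_one_of_mem_cell {φ : Fin n → G} {z z' : Fin n → G → ℝ} (hz : z ∈ cell φ)
    (hz' : z' ∈ cell φ) : dist z z' ≤ 1 := by
  refine (dist_pi_le_iff zero_le_one).2 fun v => (dist_pi_le_iff zero_le_one).2 fun x => ?_
  rw [Real.dist_eq, abs_le]
  have := hz.1 v x
  have := hz'.1 v x
  have := apply_le_one_of_mem_cell hz v x
  have := apply_le_one_of_mem_cell hz' v x
  constructor <;> linarith

open Classical in
/-- The point corresponding to a vertex of the configuration complex. -/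
noncomputable def vertex (x : Fin n × G) : Fin n → G → ℝ := Pi.single x.1 (Pi.single x.2 1)

lemma vertex_mem_cell {φ : Fin n → G} {x : Fin n × G} (hx : φ x.1 = x.2) : vertex x ∈ cell φ := by
  classical
  refine ⟨fun v h => ?_, ?_, fun v h hh => ?_⟩
  · by_cases hv : v = x.1
    · subst hv
      by_cases hh : h = x.2 <;> simp [vertex, hh]
    · simp [vertex, hv]
  · rw [Finset.sum_eq_single x.1 (fun v _ hv => by simp [vertex, hv]) (by simp)]
    simp [vertex]
  · by_cases hv : v = x.1
    · subst hv
      rw [hx] at hh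
      simp [vertex, hh]
    · simp [vertex, hv]

end Cells

lemma vertex_vadd {G : Type*} [AddCommGroup G] {n : ℕ} (g : G) (x : Fin n × G) :
    vertex (g +ᵥ x) = g +ᵥ vertex x := by
  classical
  ext v h
  rw [point_vadd_apply, prod_vadd_def, vertex, vertex]
  by_cases hv : v = x.1
  · subst hv
    simp [Pi.single_apply, sub_eq_iff_eq_add, add_comm]
  · simp [hv]

/-- Finsets of labels, nonempty and without a full row. -/
def properLabels (d : ℕ) (G : Type*) : Set (Finset (Fin (d + 1) × G)) :=
  {s | s.Nonempty ∧ ∀ j, ∃ g, (j, g) ∉ s}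

lemma card_le_of_mem_properLabels {G : Type*} [Fintype G] {d : ℕ} {s : Finset (Fin (d + 1) × G)}
    (hs : s ∈ properLabels d G) : s.card ≤ (d + 1) * (Fintype.card G - 1) := by
  classical
  choose g hg using hs.2
  have h1 : d + 1 ≤ sᶜ.card := by
    have := Finset.card_le_card_of_injOn (s := Finset.univ) (t := sᶜ) (fun j => (j, g j))
      (fun j _ => by simpa using hg j) (fun i _ j _ h => (Prod.ext_iff.1 h).1)
    simpa using this
  have h2 := Finset.card_add_card_compl s
  rw [Fintype.card_prod, Fintype.card_fin] at h2
  rw [Nat.mul_sub, mul_one]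
  omega

variable {G : Type*} [AddCommGroup G] [Fintype G]

/-- Lists of nearby points in a common cell. -/
def nearby (n : ℕ) (E : ℕ → Set G) (δ : ℝ) : Set (List (Fin n → G → ℝ)) :=
  {l | l.length ≤ n ∧ (∃ φ, IsFacet E φ ∧ ∀ z ∈ l, z ∈ cell φ) ∧ ∀ z ∈ l, ∀ z' ∈ l, dist z z' ≤ δ}

lemma hasZigzag_nearby {k ι : Type*} [Field k] [Fintype ι] {p : ℕ} (hp : p.Prime)
    (hk : (p : k) = 0) (a : ι → k) {b : ι → G} (hb : ∀ i, p • b i = 0) {N : ℕ} {E : ℕ → Set G}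
    (hne : ∀ j, (E j).Nonempty)
    (hE : ∀ j, ∀ H : AddSubgroup G, (∀ e ∈ E j, ∀ e' ∈ E j, e - e' ∈ H) → H = ⊤) (m : ℕ) :
    HasZigzag p a b N (nearby (N + 1) E ((1 - 1 / ((N + 1 : ℕ) : ℝ)) ^ m)) := by
  induction m with
  | zero =>
    refine (hasZigzag_config hp hk a hb hne hE).subdiv (Λ := fun l => bary (l.map vertex))
      (fun g l => ?_) fun l hl r hr => ?_
    · rw [← bary_vadd]
      simp [list_vadd_def, vertex_vadd, Function.comp_def]
    · obtain ⟨φ, hφ, hlφ⟩ := config_exists_facet hne hl.1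
      have hmem : ∀ z ∈ r, z ∈ cell φ := by
        clear hl
        induction hr with
        | nil => simp
        | cons h1 h2 _ ih =>
          intro z hz
          rcases List.mem_cons.1 hz with rfl | hz
          · refine bary_mem (convex_cell φ) (fun h => ?_) fun z hz => ?_
            · rw [List.map_eq_nil_iff.1 h] at h2
              simp at h2
            · obtain ⟨x, hx, rfl⟩ := List.mem_map.1 hz
              exact vertex_mem_cell (hlφ x hx)
          · exact ih (fun x hx => hlφ x (h1.subset hx)) z hz
      refine ⟨hr.length_eq.trans_le hl.2, ⟨φ, hφ, hmem⟩, fun z hz z' hz' => ?_⟩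
      rw [pow_zero]
      exact dist_le_one_of_mem_cell (hmem z hz) (hmem z' hz')
  | succ m ih =>
    refine ih.subdiv bary_vadd fun l hl r hr => ?_
    obtain ⟨h1, ⟨φ, hφ, h2⟩, h3⟩ := hl
    refine ⟨hr.length_eq.trans_le h1, ⟨φ, hφ, hr.mem_convex (convex_cell φ) h2⟩, ?_⟩
    rw [pow_succ']
    refine hr.dist_le (pow_nonneg ?_ m) h1 h3
    rw [sub_nonneg, div_le_one (by positivity)]
    exact_mod_cast Nat.succ_pos N

/-- Every equivariant labelling of the points of the configuration space admits, at every scale, a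
row whose labels all occur on nearby points of a common cell. -/
theorem exists_close_row {k ι : Type*} [Field k] [Fintype ι] {p : ℕ} [Fact p.Prime]
    [Module (ZMod p) G] [Algebra (ZMod p) k] {a : ι → k} {b : ι → G}
    (ha : LinearIndependent (ZMod p) a) (hb : Submodule.span (ZMod p) (Set.range b) = ⊤)
    {d N : ℕ} (hN : N = (d + 1) * (Fintype.card G - 1)) {E : ℕ → Set G} (hne : ∀ j, (E j).Nonempty)
    (hE : ∀ j, ∀ H : AddSubgroup G, (∀ e ∈ E j, ∀ e' ∈ E j, e - e' ∈ H) → H = ⊤)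
    {L : (Fin (N + 1) → G → ℝ) → Set (Fin (d + 1) × G)}
    (hL : ∀ (g : G) z x, g +ᵥ x ∈ L (g +ᵥ z) ↔ x ∈ L z)
    (hL' : ∀ φ, IsFacet E φ → ∀ z ∈ cell φ, (L z).Nonempty) {δ : ℝ} (hδ : 0 < δ) :
    ∃ j, ∃ φ : Fin (N + 1) → G, IsFacet E φ ∧ ∃ z : G → Fin (N + 1) → G → ℝ,
      (∀ g, z g ∈ cell φ) ∧ (∀ g h, dist (z g) (z h) ≤ δ) ∧ ∀ g, (j, g) ∈ L (z g) := by
  classical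
  by_contra hcon
  have hk : (p : k) = 0 := by
    rw [← map_natCast (algebraMap (ZMod p) k), CharP.cast_eq_zero, map_zero]
  have hbp (i : ι) : p • b i = 0 := by
    rw [← Nat.cast_smul_eq_nsmul (ZMod p), CharP.cast_eq_zero, zero_smul]
  obtain ⟨m, hm⟩ : ∃ m : ℕ, (1 - 1 / ((N + 1 : ℕ) : ℝ)) ^ m < δ := by
    refine exists_pow_lt_of_lt_one hδ ?_
    have : (0 : ℝ) < 1 / ((N + 1 : ℕ) : ℝ) := by positivity
    linarith
  let Λ (l : List (Fin (N + 1) → G → ℝ)) : Finset (Fin (d + 1) × G) := {x | ∃ z ∈ l, x ∈ L z}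
  have hmemΛ (l) (x) : x ∈ Λ l ↔ ∃ z ∈ l, x ∈ L z := by simp [Λ]
  have hΛ (g : G) (l) : Λ (g +ᵥ l) = g +ᵥ Λ l := by
    ext x
    rw [← Finset.neg_vadd_mem_iff, hmemΛ, hmemΛ, list_vadd_def]
    simp only [List.mem_map, exists_exists_and_eq_and]
    refine exists_congr fun z => and_congr_right fun _ => ?_
    rw [← hL g z, vadd_neg_vadd]
  have hz := (hasZigzag_nearby Fact.out hk a hbp hne hE m (N := N)).subdiv (Λ := Λ)
    (W := {r | r.Pairwise (· ≥ ·) ∧ ∀ s ∈ r, s ∈ properLabels d G}) hΛ fun l hl r hr => by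
      have hr' : ∀ s ∈ r, ∃ l' : List _, l'.Sublist l ∧ l' ≠ [] ∧ s = Λ l' := by
        clear hl
        induction hr with
        | nil => simp
        | @cons l l₀ r h1 h2 _ ih =>
          intro s hs
          rcases List.mem_cons.1 hs with rfl | hs
          · exact ⟨l, List.Sublist.refl l, by rintro rfl; simp at h2, rfl⟩
          · obtain ⟨l', e1, e2, e3⟩ := ih s hs
            exact ⟨l', e1.trans h1, e2, e3⟩
      have hmono {l l' : List (Fin (N + 1) → G → ℝ)} (h : l'.Sublist l) : Λ l' ≤ Λ l := by
        intro x hx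
        rw [hmemΛ] at hx ⊢
        obtain ⟨z, hz, hz'⟩ := hx
        exact ⟨z, h.subset hz, hz'⟩
      refine ⟨?_, fun s hs => ?_⟩
      · clear hl hr'
        have hle {l r} (hr : IsFlag Λ l r) : ∀ s ∈ r, s ≤ Λ l := by
          induction hr with
          | nil => simp
          | cons h1 h2 _ ih =>
            intro s hs
            rcases List.mem_cons.1 hs with rfl | hs
            · exact le_rfl
            · exact (ih s hs).trans (hmono h1)
        induction hr with
        | nil => simp
        | cons h1 h2 h3 ih =>
          exact List.pairwise_cons.2 ⟨fun s hs => (hle h3 s hs).trans (hmono h1), ih⟩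
      · obtain ⟨l', e1, e2, rfl⟩ := hr' s hs
        obtain ⟨-, ⟨φ, hφ, h2⟩, h3⟩ := hl
        refine ⟨?_, fun j => ?_⟩
        · obtain ⟨z, hz⟩ := List.exists_mem_of_ne_nil l' e2
          obtain ⟨x, hx⟩ := hL' φ hφ z (h2 z (e1.subset hz))
          exact ⟨x, (hmemΛ _ _).2 ⟨z, hz, hx⟩⟩
        · by_contra! hall
          simp only [hmemΛ] at hall
          choose z hz1 hz2 using hall
          exact hcon ⟨j, φ, hφ, z, fun g => h2 _ (e1.subset (hz1 g)),
            fun g h => (h3 _ (e1.subset (hz1 g)) _ (e1.subset (hz1 h))).trans hm.le, hz2⟩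
  obtain ⟨x, h0, h1, h2⟩ := hz
  refine no_zigzag ha hb (β := Finset (Fin (d + 1) × G)) (B := properLabels d G) (N := N)
    (ρ := Finset.card) ?_ ?_ ?_ Finset.card_strictMono ?_ h0 h1 h2
  · intro g s t
    simp only [ssubset_iff_subset_not_subset,
      Finset.vadd_finset_subset_vadd_finset_iff]
  · rintro g s ⟨h1, h2⟩
    refine ⟨h1.vadd_finset, fun j => ?_⟩
    obtain ⟨h, hh⟩ := h2 j
    refine ⟨g + h, fun hmem => hh ?_⟩
    have : g +ᵥ (j, h) ∈ g +ᵥ s := hmem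
    rwa [Finset.vadd_mem_vadd_finset_iff] at this
  · rintro s ⟨⟨⟨j, h⟩, hs⟩, h2⟩
    by_contra! hfix
    obtain ⟨g, hg⟩ := h2 j
    refine hg ?_
    rw [← hfix (g - h), show (j, g) = (g - h) +ᵥ (j, h) by rw [prod_vadd_def]; simp,
      Finset.vadd_mem_vadd_finset_iff]
    exact hs
  · exact fun s hs => ⟨hs.1.card_pos.ne', by rw [hN]; exact card_le_of_mem_properLabels hs⟩

lemma isCompact_cell {G : Type*} [Fintype G] {n : ℕ} (φ : Fin n → G) : IsCompact (cell φ) := by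
  refine (isCompact_Icc (a := (0 : Fin n → G → ℝ)) (b := 1)).of_isClosed_subset ?_ ?_
  · simp only [cell, Set.ofPred_and, Set.ofPred_forall]
    refine ((isClosed_iInter fun v => isClosed_iInter fun x => ?_).inter
      ((isClosed_eq (by fun_prop) continuous_const).inter
      (isClosed_iInter fun v => isClosed_iInter fun x => isClosed_iInter fun _ => ?_)))
    · exact isClosed_le continuous_const (by fun_prop)
    · exact isClosed_eq (by fun_prop) continuous_const
  · exact fun z hz => ⟨fun v x => hz.1 v x, fun v x => apply_le_one_of_mem_cell hz v x⟩

/-- An equivariant test map on the configuration space takes a value with constant rows. -/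
theorem exists_constant_rows {G : Type*} [AddCommGroup G] [Fintype G] {k ι : Type*} [Field k]
    [Fintype ι] {p : ℕ} [Fact p.Prime] [Module (ZMod p) G] [Algebra (ZMod p) k] {a : ι → k}
    {b : ι → G} (ha : LinearIndependent (ZMod p) a)
    (hb : Submodule.span (ZMod p) (Set.range b) = ⊤) {d N : ℕ}
    (hN : N = (d + 1) * (Fintype.card G - 1)) {E : ℕ → Set G} (hne : ∀ j, (E j).Nonempty)
    (hE : ∀ j, ∀ H : AddSubgroup G, (∀ e ∈ E j, ∀ e' ∈ E j, e - e' ∈ H) → H = ⊤)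
    {H : (Fin (N + 1) → ℝ) → Fin (d + 1) → ℝ} (hH : ContinuousOn H {x | ∀ v, 0 ≤ x v}) :
    ∃ φ : Fin (N + 1) → G, IsFacet E φ ∧ ∃ z ∈ cell φ, ∀ j g h,
      H (fun v => z v g) j = H (fun v => z v h) j := by
  by_contra! hcon
  let F (z : Fin (N + 1) → G → ℝ) (j : Fin (d + 1)) (g : G) : ℝ := H (fun v => z v g) j
  let X : Set (Fin (N + 1) → G → ℝ) := ⋃ φ ∈ {φ | IsFacet E φ}, cell φ
  have hX : IsCompact X := (Set.toFinite _).isCompact_biUnion fun φ _ => isCompact_cell φ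
  have hmemX {z} : z ∈ X ↔ ∃ φ, IsFacet E φ ∧ z ∈ cell φ := by simp [X]
  have hF : ContinuousOn F X := by
    refine continuousOn_pi.2 fun j => continuousOn_pi.2 fun g => ?_
    have h1 : ContinuousOn (fun z : Fin (N + 1) → G → ℝ => H fun v => z v g) X := by
      refine hH.comp (by fun_prop) fun z hz v => ?_
      obtain ⟨φ, -, hz⟩ := hmemX.1 hz
      exact hz.1 v g
    exact continuousOn_pi.1 h1 j
  have hFapp (j g) : ContinuousOn (fun z => F z j g) X :=
    continuousOn_pi.1 (continuousOn_pi.1 hF j) g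
  obtain ⟨ε, hε, hspread⟩ := hX.exists_forall_le' (a := (0 : ℝ))
    (f := fun z => ∑ j, ∑ g, ∑ h, |F z j g - F z j h|)
    (continuousOn_finsetSum _ fun j _ => continuousOn_finsetSum _ fun g _ =>
      continuousOn_finsetSum _ fun h _ => ((hFapp j g).sub (hFapp j h)).abs) fun z hz => by
    obtain ⟨φ, hφ, hz⟩ := hmemX.1 hz
    obtain ⟨j, g, h, hne⟩ := hcon φ hφ z hz
    refine Finset.sum_pos' (fun _ _ => by positivity) ⟨j, Finset.mem_univ _, ?_⟩
    refine Finset.sum_pos' (fun _ _ => by positivity) ⟨g, Finset.mem_univ _, ?_⟩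
    refine Finset.sum_pos' (fun _ _ => by positivity) ⟨h, Finset.mem_univ _, ?_⟩
    exact abs_pos.2 (sub_ne_zero.2 hne)
  have hq : (0 : ℝ) < Fintype.card G := by exact_mod_cast Fintype.card_pos
  let η : ℝ := ε / ((d + 1) * (Fintype.card G * Fintype.card G))
  have hη : 0 < η := by positivity
  have hspread' {z} (hz : z ∈ X) : ∃ j g h, F z j h + η ≤ F z j g := by
    by_contra! hlt
    have habs (j g h) : |F z j g - F z j h| < η :=
      abs_sub_lt_iff.2 ⟨by linarith [hlt j g h], by linarith [hlt j h g]⟩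
    refine (hspread z hz).not_gt ?_
    calc ∑ j, ∑ g, ∑ h, |F z j g - F z j h| < ∑ j : Fin (d + 1), ∑ g : G, ∑ h : G, η :=
          Finset.sum_lt_sum_of_nonempty Finset.univ_nonempty fun j _ =>
            Finset.sum_lt_sum_of_nonempty Finset.univ_nonempty fun g _ =>
              Finset.sum_lt_sum_of_nonempty Finset.univ_nonempty fun h _ => habs j g h
      _ = ε := by
        simp only [Finset.sum_const, Finset.card_univ, Fintype.card_fin, nsmul_eq_mul, η]
        push_cast
        field_simp
  obtain ⟨δ, hδ, hunif⟩ := Metric.uniformContinuousOn_iff.1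
    (hX.uniformContinuousOn_of_continuous hF) (η / 2) (half_pos hη)
  let L (z : Fin (N + 1) → G → ℝ) : Set (Fin (d + 1) × G) :=
    {x | (∀ h, F z x.1 h ≤ F z x.1 x.2) ∧ ∃ h, F z x.1 h + η ≤ F z x.1 x.2}
  have hFg (g : G) (z j h) : F (g +ᵥ z) j h = F z j (h - g) := rfl
  obtain ⟨j, φ, hφ, z, hz, hdist, hlab⟩ := exists_close_row ha hb hN hne hE (L := L)
    (fun g z x => by
      simp only [L, Set.mem_ofPred_eq, prod_vadd_def, hFg, add_sub_cancel_left]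
      refine and_congr ?_ ?_
      · exact ((Equiv.subRight g).forall_congr_left (p := fun h => F z x.1 (h - g) ≤ _)).trans
          (by simp)
      · exact ((Equiv.subRight g).exists_congr_left (p := fun h => F z x.1 (h - g) + η ≤ _)).trans
          (by simp))
    (fun φ hφ z hz => by
      obtain ⟨j, g, h, hgh⟩ := hspread' (hmemX.2 ⟨φ, hφ, hz⟩)
      obtain ⟨m, hm⟩ := Finite.exists_max (F z j)
      exact ⟨(j, m), hm, h, hgh.trans (hm g)⟩) (half_pos hδ)
  obtain ⟨-, h, hh⟩ := hlab 0
  have h1 := (hlab h).1 0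
  have hclose (g : G) : |F (z 0) j g - F (z h) j g| < η / 2 := by
    have := hunif (z 0) (hmemX.2 ⟨φ, hφ, hz 0⟩) (z h) (hmemX.2 ⟨φ, hφ, hz h⟩)
      ((hdist 0 h).trans_lt (half_lt_self hδ))
    exact ((dist_le_pi_dist (F (z 0) j) (F (z h) j) g).trans
      (dist_le_pi_dist (F (z 0)) (F (z h)) j)).trans_lt this
  have h2 := abs_lt.1 (hclose 0)
  have h3 := abs_lt.1 (hclose h)
  simp only at h1 hh
  linarith [h2.1, h2.2, h3.1, h3.2]

section Homogenize

variable {n d : ℕ}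

/-- The homogeneous extension of a map on the standard simplex, with the degree as an extra
coordinate. -/
noncomputable def homogenize (f : (Fin n → ℝ) → Fin d → ℝ) (x : Fin n → ℝ) : Fin (d + 1) → ℝ :=
  Fin.snoc (α := fun _ => ℝ) ((∑ v, x v) • f ((∑ v, x v)⁻¹ • x)) (∑ v, x v)

lemma homogenize_last (f : (Fin n → ℝ) → Fin d → ℝ) (x : Fin n → ℝ) :
    homogenize f x (Fin.last d) = ∑ v, x v := by
  simp [homogenize]

lemma homogenize_castSucc (f : (Fin n → ℝ) → Fin d → ℝ) (x : Fin n → ℝ) (j : Fin d) :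
    homogenize f x j.castSucc = (∑ v, x v) * f ((∑ v, x v)⁻¹ • x) j := by
  simp [homogenize]

lemma inv_smul_mem_stdSimplex {x : Fin n → ℝ} (hx : ∀ v, 0 ≤ x v) (h : ∑ v, x v ≠ 0) :
    (∑ v, x v)⁻¹ • x ∈ stdSimplex ℝ (Fin n) := by
  have := Finset.sum_nonneg fun v (_ : v ∈ Finset.univ) => hx v
  refine ⟨fun v => ?_, ?_⟩
  · have := hx v
    simp only [Pi.smul_apply, smul_eq_mul]
    positivity
  · simp [← Finset.mul_sum, h]

lemma continuousOn_homogenize {f : (Fin n → ℝ) → Fin d → ℝ}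
    (hf : ContinuousOn f (stdSimplex ℝ (Fin n))) :
    ContinuousOn (homogenize f) {x | ∀ v, 0 ≤ x v} := by
  have hsum : Continuous fun x : Fin n → ℝ => ∑ v, x v := by fun_prop
  suffices h : ContinuousOn (fun x : Fin n → ℝ => (∑ v, x v) • f ((∑ v, x v)⁻¹ • x))
      {x | ∀ v, 0 ≤ x v} by
    refine continuousOn_pi.2 fun j => ?_
    induction j using Fin.lastCases with
    | last => simpa only [homogenize_last] using hsum.continuousOn
    | cast j =>
      simp only [homogenize_castSucc]
      exact continuousOn_pi.1 h j
  intro x hx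
  by_cases h0 : ∑ v, x v = 0
  · obtain ⟨C, hC⟩ := (isCompact_stdSimplex ℝ (Fin n)).exists_bound_of_continuousOn hf
    unfold ContinuousWithinAt
    beta_reduce
    rw [h0, zero_smul]
    refine squeeze_zero_norm' (a := fun y => |∑ v, y v| * C) ?_ ?_
    · filter_upwards [self_mem_nhdsWithin] with y hy
      by_cases hy0 : ∑ v, y v = 0
      · simp [hy0]
      · rw [norm_smul, Real.norm_eq_abs]
        exact mul_le_mul_of_nonneg_left (hC _ (inv_smul_mem_stdSimplex hy hy0)) (abs_nonneg _)
    · have : Filter.Tendsto (fun y : Fin n → ℝ => |∑ v, y v| * C) (nhds x)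
          (nhds (|∑ v, x v| * C)) :=
        (hsum.abs.mul continuous_const).tendsto x
      rw [h0, abs_zero, zero_mul] at this
      exact this.mono_left nhdsWithin_le_nhds
  · have hopen : {y : Fin n → ℝ | ∑ v, y v ≠ 0} ∈ nhds x := hsum.continuousAt.eventually_ne h0
    refine (continuousWithinAt_inter hopen).1 ?_
    have hinv : ContinuousOn (fun y : Fin n → ℝ => (∑ v, y v)⁻¹ • y)
        ({x | ∀ v, 0 ≤ x v} ∩ {y | ∑ v, y v ≠ 0}) :=
      (hsum.continuousOn.inv₀ fun y hy => hy.2).smul continuousOn_id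
    exact hsum.continuousOn.smul
      (hf.comp hinv fun y hy => inv_smul_mem_stdSimplex hy.1 hy.2) x ⟨hx, h0⟩

end Homogenize

lemma mem_simplexFace {n : ℕ} {s : Finset (Fin n)} {x : Fin n → ℝ} (hx : x ∈ stdSimplex ℝ (Fin n))
    (hs : ∀ v ∉ s, x v = 0) : x ∈ simplexFace s := by
  have hsum (y : Fin n → ℝ) : ∑ v ∈ s, x v * y v = ∑ v, x v * y v :=
    Finset.sum_subset (Finset.subset_univ s) fun v _ hv => by rw [hs v hv, zero_mul]
  have e : x = ∑ v ∈ s, x v • (Pi.single v 1 : Fin n → ℝ) := by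
    ext i
    simp only [Finset.sum_apply, Pi.smul_apply, smul_eq_mul]
    rw [hsum fun v => (Pi.single v 1 : Fin n → ℝ) i]
    simp [Pi.single_apply]
  rw [e]
  refine (convex_convexHull ℝ _).sum_mem (fun v _ => hx.1 v) ?_ fun v hv =>
    subset_convexHull ℝ _ ⟨v, hv, rfl⟩
  simpa [hx.2] using hsum 1

open Classical in
/-- The faces spanned by the fibres of `φ` are nonempty and their images have a common point. -/
def IsTverberg {G : Type*} {n d : ℕ} (f : (Fin n → ℝ) → Fin d → ℝ) (φ : Fin n → G) : Prop :=
  (∀ g, ∃ v, φ v = g) ∧ (⋂ g, f '' simplexFace {v | φ v = g}).Nonempty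

lemma isTverberg_of_homogenize_eq {G : Type*} [Fintype G] {n d : ℕ} {f : (Fin n → ℝ) → Fin d → ℝ}
    {φ : Fin n → G} {z : Fin n → G → ℝ} (hz : z ∈ cell φ)
    (hrow : ∀ j g h, homogenize f (fun v => z v g) j = homogenize f (fun v => z v h) j) :
    IsTverberg f φ := by
  classical
  have hmass (g h : G) : ∑ v, z v g = ∑ v, z v h := by
    simpa only [homogenize_last] using hrow (Fin.last d) g h
  have htot : ∑ g, ∑ v, z v g = 1 := by
    rw [Finset.sum_comm]
    exact hz.2.1
  have hne (g : G) : ∑ v, z v g ≠ 0 := by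
    intro h0
    rw [Finset.sum_eq_zero fun h _ => (hmass h g).trans h0] at htot
    exact zero_ne_one htot
  refine ⟨fun g => ?_, ?_⟩
  · obtain ⟨v, -, hv⟩ := Finset.exists_ne_zero_of_sum_ne_zero (hne g)
    exact ⟨v, by_contra fun hvg => hv (hz.2.2 v g (Ne.symm hvg))⟩
  · let x (g : G) : Fin n → ℝ := (∑ v, z v g)⁻¹ • fun v => z v g
    have hf (g h : G) : f (x g) = f (x h) := by
      ext j
      have := hrow j.castSucc g h
      rw [homogenize_castSucc, homogenize_castSucc, hmass g h] at this
      simpa only [x, hmass g h] using mul_left_cancel₀ (hne h) this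
    obtain ⟨g₀⟩ : Nonempty G := by
      by_contra hG
      rw [not_nonempty_iff] at hG
      simp at htot
    refine ⟨f (x g₀), Set.mem_iInter.2 fun g => ⟨x g, ?_, hf g g₀⟩⟩
    refine mem_simplexFace (inv_smul_mem_stdSimplex (fun v => hz.1 v g) (hne g)) fun v hv => ?_
    have hvg : g ≠ φ v := fun h => hv (by simp [h])
    simp [x, hz.2.2 v g hvg]

section Counting

variable {G : Type*} {n d : ℕ}

lemma IsTverberg.add_left [AddGroup G] {f : (Fin n → ℝ) → Fin d → ℝ} {φ : Fin n → G}
    (h : IsTverberg f φ) (g : G) : IsTverberg f fun v => g + φ v := by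
  have hiff (v x) : φ v = -g + x ↔ g + φ v = x := eq_neg_add_iff_add_eq
  refine ⟨fun x => ?_, ?_⟩
  · obtain ⟨v, hv⟩ := h.1 (-g + x)
    exact ⟨v, (hiff v x).1 hv⟩
  · obtain ⟨y, hy⟩ := h.2
    refine ⟨y, Set.mem_iInter.2 fun x => ?_⟩
    convert Set.mem_iInter.1 hy (-g + x) using 4
    exact (hiff _ x).symm

/-- If the translation invariant set `T` contains facets for all translates of the differences `S`,
then it is large. -/
lemma card_pow_le_of_exists_facet [AddCommGroup G] [Fintype G] {T : Set (Fin (n + 1) → G)}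
    {S : Finset G} (hT : ∀ φ ∈ T, ∀ g, (fun v => g + φ v) ∈ T)
    (h : ∀ c : ℕ → G, ∃ φ ∈ T, IsFacet (fun j => {x | x - c j ∈ S}) φ) :
    Fintype.card G ^ ((n + 1) / 2 + 1) ≤ T.ncard * S.card ^ ((n + 1) / 2) := by
  set m := (n + 1) / 2 with hm
  let lo (j : Fin m) : Fin (n + 1) := ⟨2 * j, by omega⟩
  let hi (j : Fin m) : Fin (n + 1) := ⟨2 * j + 1, by omega⟩
  let Ψ (y : T × (Fin m → S)) : G × (Fin m → G) :=
    (y.1.1 0, fun j => y.1.1 (hi j) - y.1.1 (lo j) - y.2 j)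
  have hΨ : Function.Surjective Ψ := by
    rintro ⟨g, c⟩
    obtain ⟨φ, hφ, hfacet⟩ := h fun j => if hj : j < m then c ⟨j, hj⟩ else 0
    have hdiff (j : Fin m) : φ (hi j) - φ (lo j) - c j ∈ S := by
      have hj : (lo j : ℕ) / 2 = j := by simp [lo]
      have := hfacet (lo j) (hi j) (by simp [lo, hi, Fin.lt_def]) (by simp only [lo, hi]; omega)
      simpa [hj] using this
    refine ⟨(⟨_, hT φ hφ (g - φ 0)⟩, fun j => ⟨_, hdiff j⟩), Prod.ext ?_ (funext fun j => ?_)⟩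
    · simp [Ψ]
    · simp only [Ψ]
      abel
  have := Nat.card_le_card_of_surjective Ψ hΨ
  rw [Nat.card_prod, Nat.card_prod, Nat.card_coe_set_eq] at this
  simp only [Nat.card_eq_fintype_card, Fintype.card_pi_const, Fintype.card_coe] at this
  rwa [pow_succ']

variable [Fintype G]

open Classical in
/-- The set of fibres of `φ`. -/
noncomputable def fibers (φ : Fin n → G) : Finset (Finset (Fin n)) :=
  Finset.univ.image fun g => ({v | φ v = g} : Finset (Fin n))

lemma exists_perm_of_fibers_eq {φ ψ : Fin n → G} (hψ : Function.Surjective ψ)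
    (h : fibers φ = fibers ψ) : ∃ σ : Equiv.Perm G, φ = σ ∘ ψ := by
  classical
  have hker (v w) : φ v = φ w ↔ ψ v = ψ w := by
    have aux {φ ψ : Fin n → G} (h : fibers φ = fibers ψ) (hvw : φ v = φ w) : ψ v = ψ w := by
      have hmem : ({u | φ u = φ w} : Finset (Fin n)) ∈ fibers ψ := by
        rw [← h]
        exact Finset.mem_image_of_mem _ (Finset.mem_univ _)
      obtain ⟨x, -, hx⟩ := Finset.mem_image.1 hmem
      have hmem' (u) : ψ u = x ↔ φ u = φ w := by simpa using Finset.ext_iff.1 hx u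
      rw [(hmem' v).2 hvw, (hmem' w).2 rfl]
    exact ⟨aux h, aux h.symm⟩
  have hinj : Function.Injective fun g => φ (Function.surjInv hψ g) := fun g g' hg => by
    simpa only [Function.surjInv_eq] using (hker _ _).1 hg
  refine ⟨Equiv.ofBijective _ (Finite.injective_iff_bijective.1 hinj), funext fun v => ?_⟩
  exact (hker _ _).2 (Function.surjInv_eq hψ (ψ v)).symm

lemma IsTverberg.fibers_mem {f : (Fin n → ℝ) → Fin d → ℝ} {φ : Fin n → G} (h : IsTverberg f φ) :
    fibers φ ∈ {Q : Finset (Finset (Fin n)) | Q.card = Fintype.card G ∧ (∀ s ∈ Q, s.Nonempty) ∧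
      (∀ s ∈ Q, ∀ t ∈ Q, s ≠ t → Disjoint s t) ∧ (⋂ s ∈ Q, f '' simplexFace s).Nonempty} := by
  classical
  refine ⟨?_, ?_, ?_, ?_⟩
  · refine (Finset.card_image_of_injective _ fun g g' hg => ?_).trans Finset.card_univ
    obtain ⟨v, rfl⟩ := h.1 g
    simpa using Finset.ext_iff.1 hg v
  · intro s hs
    obtain ⟨g, -, rfl⟩ := Finset.mem_image.1 hs
    obtain ⟨v, hv⟩ := h.1 g
    exact ⟨v, by simpa using hv⟩
  · intro s hs t ht hst
    obtain ⟨g, -, rfl⟩ := Finset.mem_image.1 hs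
    obtain ⟨g', -, rfl⟩ := Finset.mem_image.1 ht
    refine Finset.disjoint_filter.2 fun v _ hv hv' => hst ?_
    rw [← hv, ← hv']
  · obtain ⟨y, hy⟩ := h.2
    refine ⟨y, Set.mem_iInter₂.2 fun s hs => ?_⟩
    obtain ⟨g, -, rfl⟩ := Finset.mem_image.1 hs
    exact Set.mem_iInter.1 hy g

lemma ncard_isTverberg_le (f : (Fin n → ℝ) → Fin d → ℝ) :
    {φ : Fin n → G | IsTverberg f φ}.ncard ≤
      {Q : Finset (Finset (Fin n)) | Q.card = Fintype.card G ∧ (∀ s ∈ Q, s.Nonempty) ∧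
        (∀ s ∈ Q, ∀ t ∈ Q, s ≠ t → Disjoint s t) ∧
        (⋂ s ∈ Q, f '' simplexFace s).Nonempty}.ncard * (Fintype.card G).factorial := by
  classical
  set P := {Q : Finset (Finset (Fin n)) | Q.card = Fintype.card G ∧ (∀ s ∈ Q, s.Nonempty) ∧
    (∀ s ∈ Q, ∀ t ∈ Q, s ≠ t → Disjoint s t) ∧ (⋂ s ∈ Q, f '' simplexFace s).Nonempty}
  rcases Set.eq_empty_or_nonempty {φ : Fin n → G | IsTverberg f φ} with h0 | ⟨φ₀, hφ₀⟩
  · simp [h0]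
  let rep (Q : Finset (Finset (Fin n))) : Fin n → G :=
    if h : ∃ φ : Fin n → G, IsTverberg f φ ∧ fibers φ = Q then h.choose else φ₀
  calc {φ : Fin n → G | IsTverberg f φ}.ncard
      ≤ ((fun y : Finset (Finset (Fin n)) × Equiv.Perm G => y.2 ∘ rep y.1) ''
          (P ×ˢ Set.univ)).ncard := by
        refine Set.ncard_le_ncard (fun φ hφ => ?_) (Set.toFinite _)
        have hex : ∃ ψ : Fin n → G, IsTverberg f ψ ∧ fibers ψ = fibers φ := ⟨φ, hφ, rfl⟩
        have hrep : rep (fibers φ) = hex.choose := dif_pos hex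
        obtain ⟨σ, hσ⟩ := exists_perm_of_fibers_eq (ψ := rep (fibers φ))
          (hrep ▸ hex.choose_spec.1.1) (hrep ▸ hex.choose_spec.2.symm)
        exact ⟨(fibers φ, σ), ⟨hφ.fibers_mem, Set.mem_univ _⟩, hσ.symm⟩
    _ ≤ (P ×ˢ (Set.univ : Set (Equiv.Perm G))).ncard := Set.ncard_image_le (Set.toFinite _)
    _ = P.ncard * (Fintype.card G).factorial := by
        rw [Set.ncard_prod, Set.ncard_univ, Nat.card_eq_fintype_card, Fintype.card_perm]

end Counting

lemma card_pow_le_ncard_isTverberg {p r d N : ℕ} [Fact p.Prime] (hr : r ≠ 0)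
    (hN : N = (d + 1) * (p ^ r - 1)) {f : (Fin (N + 1) → ℝ) → Fin d → ℝ}
    (hf : ContinuousOn f (stdSimplex ℝ (Fin (N + 1)))) :
    (p ^ r) ^ ((N + 1) / 2 + 1) ≤
      {φ : Fin (N + 1) → Fin r → ZMod p | IsTverberg f φ}.ncard * (r + 1) ^ ((N + 1) / 2) := by
  classical
  have hcard : Fintype.card (Fin r → ZMod p) = p ^ r := by simp [ZMod.card]
  let b (i : Fin r) : Fin r → ZMod p := Pi.single i 1
  have hb : Submodule.span (ZMod p) (Set.range b) = ⊤ := by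
    have := (Pi.basisFun (ZMod p) (Fin r)).span_eq
    rwa [show ⇑(Pi.basisFun (ZMod p) (Fin r)) = b from funext fun i => by simp [b]] at this
  let a := Module.finBasisOfFinrankEq (ZMod p) (GaloisField p r) (GaloisField.finrank p hr)
  let S : Finset (Fin r → ZMod p) := insert 0 (Finset.univ.image b)
  have hS : S.card ≤ r + 1 :=
    (Finset.card_insert_le _ _).trans
      (Nat.succ_le_succ (Finset.card_image_le.trans_eq (by simp)))
  have hmem (c : Fin r → ZMod p) {s} (hs : s ∈ S) : c + s ∈ {x | x - c ∈ S} := by simpa using hs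
  refine le_trans ?_ (Nat.mul_le_mul_left _ (Nat.pow_le_pow_left hS _))
  rw [← hcard]
  refine card_pow_le_of_exists_facet (fun φ hφ g => hφ.add_left g) fun c => ?_
  obtain ⟨φ, hφ, z, hz, hrow⟩ := exists_constant_rows a.linearIndependent hb (by rwa [hcard])
    (E := fun j => {x | x - c j ∈ S}) (fun j => ⟨_, hmem (c j) (Finset.mem_insert_self _ _)⟩)
    (fun j H hH => by
      have hspan : Submodule.span (ZMod p) (Set.range b) ≤ AddSubgroup.toZModSubmodule p H := by
        refine Submodule.span_le.2 ?_
        rintro _ ⟨i, rfl⟩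
        have := hH _ (hmem (c j) (Finset.mem_insert_of_mem
          (Finset.mem_image_of_mem b (Finset.mem_univ i)))) _
          (hmem (c j) (Finset.mem_insert_self _ _))
        simpa using this
      rw [hb] at hspan
      exact eq_top_iff.2 fun x _ => hspan (Submodule.mem_top (x := x)))
    (continuousOn_homogenize hf)
  exact ⟨φ, isTverberg_of_homogenize_eq hz hrow, hφ⟩

end Tverberg

/-- **Lower bound for the topological Tverberg theorem** (Vućić–Živaljević, Hell).
Let `q = p^r` be a prime power, `d ≥ 1`, and `N = (d + 1)(q - 1)`. For any continuous
map `f : σ^N → ℝ^d`, the number of unordered `q`-tuples `{F₁, …, F_q}` of pairwise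
disjoint faces of the `N`-simplex with `⋂ᵢ f(Fᵢ) ≠ ∅` is at least
`(1 / (q-1)!) ⬝ (q / (r+1)) ^ ⌈N/2⌉`. -/
theorem topological_tverberg_lower_bound {p r d q N : ℕ}
    (hp : p.Prime) (hr : 1 ≤ r) (hq : q = p ^ r) (hd : 1 ≤ d)
    (hN : N = (d + 1) * (q - 1))
    (f : (Fin (N + 1) → ℝ) → (Fin d → ℝ))
    (hf : ContinuousOn f (stdSimplex ℝ (Fin (N + 1)))) :
    (1 / (Nat.factorial (q - 1) : ℝ)) * ((q : ℝ) / ((r : ℝ) + 1)) ^ ((N + 1) / 2) ≤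
      (Set.ncard {Q : Finset (Finset (Fin (N + 1))) |
        Q.card = q ∧
        (∀ s ∈ Q, s.Nonempty) ∧
        (∀ s ∈ Q, ∀ t ∈ Q, s ≠ t → Disjoint s t) ∧
        (⋂ s ∈ Q, f '' simplexFace s).Nonempty} : ℝ) := by
  have : Fact p.Prime := ⟨hp⟩
  have hcard : Fintype.card (Fin r → ZMod p) = q := by simp [ZMod.card, hq]
  have hT := Tverberg.ncard_isTverberg_le (G := Fin r → ZMod p) f
  rw [hcard] at hT
  have hpow := Tverberg.card_pow_le_ncard_isTverberg (p := p) (r := r) (by omega)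
    (by rwa [← hq]) hf
  rw [← hq] at hpow
  have hmain := hpow.trans (Nat.mul_le_mul_right _ hT)
  have hq0 : 0 < q := hq ▸ pow_pos hp.pos r
  rw [← Nat.mul_factorial_pred hq0.ne', pow_succ'] at hmain
  have hle := Nat.le_of_mul_le_mul_left (hmain.trans_eq (by ring :
    _ = q * (_ * (q - 1).factorial * (r + 1) ^ ((N + 1) / 2)))) hq0
  rw [div_pow, one_div, inv_mul_le_iff₀ (by positivity), div_le_iff₀ (by positivity), mul_comm
    ((q - 1).factorial : ℝ)]
  exact_mod_cast hle
end
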